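/- arXiv:1010.5311 — 4 statements merged into one kernel-verified Lean document; each statement's English description precedes it below -/
import Mathlib

section
/- Let La(n,D_2) denote the maximum size of a diamond-free family of subsets of [n]. If the sequence La(n,D_2)/C(n,⌊n/2⌋) converges to a limit L as n → ∞, then 2 ≤ L ≤ 25/11. -/
open Finset Filter

/-- `F` is `D_k`-free: there are no pairwise distinct `A, B_1, …, B_k, C ∈ F`
with `A ⊆ B_i ⊆ C` for all `i`. -/
def DkFree (n k : ℕ) (F : Finset (Finset (Fin n))) : Prop :=
  ¬ ∃ (A C : Finset (Fin n)) (B : Fin k → Finset (Fin n)),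
      A ∈ F ∧ C ∈ F ∧ (∀ i, B i ∈ F) ∧
      Function.Injective B ∧ (∀ i, B i ≠ A ∧ B i ≠ C) ∧ A ≠ C ∧
      (∀ i, A ⊆ B i ∧ B i ⊆ C)

/-- `La(n, D_2)`: the maximum size of a diamond-free family of subsets of `[n]`. -/
noncomputable def LaDiamond (n : ℕ) : ℕ :=
  sSup {c : ℕ | ∃ F : Finset (Finset (Fin n)), DkFree n 2 F ∧ F.card = c}

/-- Twelve times an upper bound for the weight of a full chain, as a function of which singletons
(`x`) and pairs (`e`) formed by its first four elements belong to the family. -/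
def chainVal (x0 x1 x2 x3 e01 e02 e03 e12 e13 e23 : Bool) : ℕ :=
  if x0 then
    if x1 then 12 else if e01 then 18 else if x2 || e02 || e12 then 12 else 16
  else if x1 then
    if e01 then 18 else if x2 || e02 || e12 then 0 else 16
  else if e01 then
    if x2 || e02 || e12 then 12 else 16
  else if x2 then
    if e02 || e12 then 0 else 16
  else if e02 && e12 then 0
  else if e02 || e12 then 16
  else if x3 then
    if e03 || e13 || e23 then 12 else 15
  else if (e03 && e13) || (e03 && e23) || (e13 && e23) then 12
  else if e03 || e13 || e23 then 14 else 15

/-- The linear form used in the sum-of-squares certificate. -/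
def sosForm (xu xv xw euv euw evw : Bool) : ℤ :=
  if xu then
    if xv then (if xw then 5 else if euw && evw then -3 else 0)
    else if euv then (if xw then (if evw then 6 else 0) else if euw && evw then -6 else 0)
    else 0
  else if xv then 0
  else if euv then
    if xw then (if euw && evw then -3 else 0)
    else if euw && evw then 5 else if euw || evw then 0 else -3
  else
    if xw then (if euw || evw then 0 else 11)
    else if euw && evw then 0 else if euw then 4 else if evw then -4 else -1

lemma sosForm_bound (xu xv xw euv euw evw : Bool) :
    -11 ≤ sosForm xu xv xw euv euw evw ∧ sosForm xu xv xw euv euw evw ≤ 11 := by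
  revert xu xv xw euv euw evw; decide

/-- The certificate summand. -/
def certVal (x0 x1 x2 x3 e01 e02 e03 e12 e13 e23 : Bool) : ℤ :=
  9 * (chainVal x0 x1 x2 x3 e01 e02 e03 e12 e13 e23 : ℤ)
    + sosForm x0 x1 x2 e01 e02 e12 * sosForm x0 x1 x3 e01 e03 e13

/-- `certVal` of a configuration read off at four indices. -/
def certAt (x : Fin 4 → Bool) (e : Fin 4 → Fin 4 → Bool) (i j k l : Fin 4) : ℤ :=
  certVal (x i) (x j) (x k) (x l) (e i j) (e i k) (e i l) (e j k) (e j l) (e k l)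

/-- The permutations of four indices. -/
def perms4 : List (Fin 4 → Fin 4) :=
  [![0,1,2,3], ![0,1,3,2], ![0,2,1,3], ![0,2,3,1], ![0,3,1,2], ![0,3,2,1],
   ![1,0,2,3], ![1,0,3,2], ![1,2,0,3], ![1,2,3,0], ![1,3,0,2], ![1,3,2,0],
   ![2,0,1,3], ![2,0,3,1], ![2,1,0,3], ![2,1,3,0], ![2,3,0,1], ![2,3,1,0],
   ![3,0,1,2], ![3,0,2,1], ![3,1,0,2], ![3,1,2,0], ![3,2,0,1], ![3,2,1,0]]

lemma perms4_inj : ∀ p ∈ perms4, Function.Injective p := by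
  decide +kernel

lemma perms4_bij (p : Fin 4 → Fin 4) (hp : p ∈ perms4) : Function.Bijective p :=
  Finite.injective_iff_bijective.mp (perms4_inj p hp)

lemma perms4_length : perms4.length = 24 := rfl

/-- The symmetrized certificate. -/
def certSum (x0 x1 x2 x3 e01 e02 e03 e12 e13 e23 : Bool) : ℤ :=
    certVal x0 x1 x2 x3 e01 e02 e03 e12 e13 e23
  + certVal x0 x1 x3 x2 e01 e03 e02 e13 e12 e23
  + certVal x0 x2 x1 x3 e02 e01 e03 e12 e23 e13
  + certVal x0 x2 x3 x1 e02 e03 e01 e23 e12 e13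
  + certVal x0 x3 x1 x2 e03 e01 e02 e13 e23 e12
  + certVal x0 x3 x2 x1 e03 e02 e01 e23 e13 e12
  + certVal x1 x0 x2 x3 e01 e12 e13 e02 e03 e23
  + certVal x1 x0 x3 x2 e01 e13 e12 e03 e02 e23
  + certVal x1 x2 x0 x3 e12 e01 e13 e02 e23 e03
  + certVal x1 x2 x3 x0 e12 e13 e01 e23 e02 e03
  + certVal x1 x3 x0 x2 e13 e01 e12 e03 e23 e02
  + certVal x1 x3 x2 x0 e13 e12 e01 e23 e03 e02
  + certVal x2 x0 x1 x3 e02 e12 e23 e01 e03 e13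
  + certVal x2 x0 x3 x1 e02 e23 e12 e03 e01 e13
  + certVal x2 x1 x0 x3 e12 e02 e23 e01 e13 e03
  + certVal x2 x1 x3 x0 e12 e23 e02 e13 e01 e03
  + certVal x2 x3 x0 x1 e23 e02 e12 e03 e13 e01
  + certVal x2 x3 x1 x0 e23 e12 e02 e13 e03 e01
  + certVal x3 x0 x1 x2 e03 e13 e23 e01 e02 e12
  + certVal x3 x0 x2 x1 e03 e23 e13 e02 e01 e12
  + certVal x3 x1 x0 x2 e13 e03 e23 e01 e12 e02
  + certVal x3 x1 x2 x0 e13 e23 e03 e12 e01 e02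
  + certVal x3 x2 x0 x1 e23 e03 e13 e02 e12 e01
  + certVal x3 x2 x1 x0 e23 e13 e03 e12 e02 e01

set_option maxRecDepth 100000 in
lemma certSum_le : ∀ x0 x1 x2 x3 e01 e02 e03 e12 e13 e23 : Bool,
    ((!(x0 && x1 && e01)) && (!(x0 && x2 && e02)) && (!(x0 && x3 && e03)) && (!(x1 && x2 && e12))
      && (!(x1 && x3 && e13)) && (!(x2 && x3 && e23))) = true →
    certSum x0 x1 x2 x3 e01 e02 e03 e12 e13 e23 ≤ 3280 := by
  decide +kernel

lemma certAt_sum (x : Fin 4 → Bool) (e : Fin 4 → Fin 4 → Bool) (hs : ∀ i j, e i j = e j i) :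
    (perms4.map fun p => certAt x e (p 0) (p 1) (p 2) (p 3)).sum =
      certSum (x 0) (x 1) (x 2) (x 3) (e 0 1) (e 0 2) (e 0 3) (e 1 2) (e 1 3) (e 2 3) := by
  simp only [perms4, List.map_cons, List.map_nil, List.sum_cons, List.sum_nil, certAt, certSum,
    Matrix.cons_val_zero, Matrix.cons_val_one, Matrix.cons_val]
  rw [hs 1 0, hs 2 0, hs 3 0, hs 2 1, hs 3 1, hs 3 2]
  ring

lemma chainVal_ge_two {x0 x1 x2 x3 e01 e02 e03 e12 e13 e23 : Bool} :
    e01 = true → (x0 || x1) = true → (x0 && x1) = false →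
    chainVal x0 x1 x2 x3 e01 e02 e03 e12 e13 e23 = 18 := by
  revert x0 x1 x2 x3 e01 e02 e03 e12 e13 e23; decide +kernel
lemma chainVal_zero {x0 x1 x2 x3 e01 e02 e03 e12 e13 e23 : Bool} :
    chainVal x0 x1 x2 x3 e01 e02 e03 e12 e13 e23 < 12 →
    x0 = false ∧ e01 = false ∧ ((x1 && x2) || (x1 && e12) || (x1 && e02) || (x2 && e02) ||
      (x2 && e12) || (e02 && e12)) = true := by
  revert x0 x1 x2 x3 e01 e02 e03 e12 e13 e23; decide +kernel

lemma chainVal_three_single {x0 x1 x2 x3 e01 e02 e03 e12 e13 e23 : Bool} :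
    (x0 || x1 || x2) = true → (x0 && x1) = false → (x0 && x2) = false → (x1 && x2) = false →
    e01 = false → e02 = false → e12 = false →
    chainVal x0 x1 x2 x3 e01 e02 e03 e12 e13 e23 = 16 := by
  revert x0 x1 x2 x3 e01 e02 e03 e12 e13 e23; decide +kernel

lemma chainVal_three_pair {x0 x1 x2 x3 e01 e02 e03 e12 e13 e23 : Bool} :
    (e01 || e02 || e12) = true → (e01 && e02) = false → (e01 && e12) = false →
    (e02 && e12) = false → x0 = false → x1 = false → x2 = false →
    chainVal x0 x1 x2 x3 e01 e02 e03 e12 e13 e23 = 16 := by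
  revert x0 x1 x2 x3 e01 e02 e03 e12 e13 e23; decide +kernel

lemma chainVal_four_single {x0 x1 x2 x3 e01 e02 e03 e12 e13 e23 : Bool} :
    (x0 && x1) = false → (x0 && x2) = false → (x1 && x2) = false →
    e01 = false → e02 = false → e12 = false → e03 = false → e13 = false → e23 = false →
    15 ≤ chainVal x0 x1 x2 x3 e01 e02 e03 e12 e13 e23 := by
  revert x0 x1 x2 x3 e01 e02 e03 e12 e13 e23; decide +kernel

lemma chainVal_four_pair {x0 x1 x2 x3 e01 e02 e03 e12 e13 e23 : Bool} :
    x0 = false → x1 = false → x2 = false → x3 = false →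
    (e01 && e02) = false → (e01 && e12) = false → (e02 && e12) = false →
    (e03 && e13) = false → (e03 && e23) = false → (e13 && e23) = false →
    14 ≤ chainVal x0 x1 x2 x3 e01 e02 e03 e12 e13 e23 := by
  revert x0 x1 x2 x3 e01 e02 e03 e12 e13 e23; decide +kernel

/-! ### Full chains, encoded by permutations -/

open Equiv in
lemma unif_count {n : ℕ} {Y : Type*} [DecidableEq Y] (T : Perm (Fin n) → Y) (S : Finset Y)
    (hT : ∀ y ∈ S, ∀ y' ∈ S, ∃ σ : Perm (Fin n), ∀ π, T π = y ↔ T (σ * π) = y')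
    (y : Y) (hy : y ∈ S) :
    #{π | T π = y} * #S = #{π | T π ∈ S} := by
  have h1 : #{π | T π ∈ S} = ∑ z ∈ S, #{π ∈ ({π | T π ∈ S} : Finset (Perm (Fin n))) | T π = z} :=
    Finset.card_eq_sum_card_fiberwise (fun π hπ => by simpa using hπ)
  rw [h1, Finset.sum_congr rfl (g := fun _ => #{π | T π = y}), Finset.sum_const, smul_eq_mul,
    mul_comm]
  intro z hz
  obtain ⟨σ, hσ⟩ := hT y hy z hz
  symm
  refine Finset.card_equiv (Equiv.mulLeft σ) ?_
  intro π
  simp only [Finset.mem_filter, Finset.mem_univ, true_and, Equiv.coe_mulLeft]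
  rw [hσ π]
  constructor
  · intro h; exact ⟨h ▸ hz, h⟩
  · intro h; exact h.2

/-- Two colourings with equal fibre sizes differ by a permutation. -/
lemma exists_perm_of_card {α κ : Type*} [Fintype α] [DecidableEq κ] (c c' : α → κ)
    (h : ∀ k, Fintype.card {a // c a = k} = Fintype.card {a // c' a = k}) :
    ∃ σ : Equiv.Perm α, ∀ a, c' (σ a) = c a := by
  let g : ∀ k, {a // c a = k} ≃ {a // c' a = k} := fun k => Fintype.equivOfCardEq (h k)
  refine ⟨(Equiv.sigmaFiberEquiv c).symm.trans
    ((Equiv.sigmaCongrRight g).trans (Equiv.sigmaFiberEquiv c')), fun a => ?_⟩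
  exact (g (c a) ⟨a, rfl⟩).2

/-- The set of the first `k` elements. -/
def pre {n : ℕ} (π : Equiv.Perm (Fin n)) (k : ℕ) : Finset (Fin n) :=
  (univ.filter (fun i : Fin n => i.val < k)).image π

lemma pre_mul {n : ℕ} (σ π : Equiv.Perm (Fin n)) (k : ℕ) :
    pre (σ * π) k = (pre π k).image σ := by
  simp [pre, Finset.image_image]

lemma card_pre {n : ℕ} (π : Equiv.Perm (Fin n)) {k : ℕ} (hk : k ≤ n) : #(pre π k) = k := by
  rw [pre, Finset.card_image_of_injective _ π.injective, Fin.card_filter_val_lt]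
  omega

lemma pre_mono {n : ℕ} (π : Equiv.Perm (Fin n)) {k l : ℕ} (h : k ≤ l) : pre π k ⊆ pre π l := by
  apply Finset.image_subset_image
  intro i
  simp only [Finset.mem_filter, Finset.mem_univ, true_and]
  omega

lemma exists_perm_sets {n : ℕ} (A A' B : Finset (Fin n)) (hA : A ⊆ B) (hA' : A' ⊆ B)
    (hc : #A = #A') : ∃ σ : Equiv.Perm (Fin n), A.image σ = A' ∧ B.image σ = B := by
  classical
  obtain ⟨σ, hσ⟩ := exists_perm_of_card (fun a => (decide (a ∈ A), decide (a ∈ B)))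
    (fun a => (decide (a ∈ A'), decide (a ∈ B))) (by
      rintro ⟨p, q⟩
      rw [Fintype.card_subtype, Fintype.card_subtype]
      have e1 : ∀ C : Finset (Fin n), C ⊆ B → 
          #{a | (decide (a ∈ C), decide (a ∈ B)) = (p, q)} =
          if p then (if q then #C else 0) else (if q then #B - #C else n - #B) := by
        intro C hC
        rcases p with _ | _ <;> rcases q with _ | _
        · simp only [Prod.mk.injEq, decide_eq_false_iff_not]
          have : (univ.filter fun a => a ∉ C ∧ a ∉ B) = Bᶜ := by
            ext a; simp; exact fun h h' => h (hC h')
          rw [this, Finset.card_compl]; simp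
        · simp only [Prod.mk.injEq, decide_eq_false_iff_not, decide_eq_true_eq]
          have : (univ.filter fun a => a ∉ C ∧ a ∈ B) = B \ C := by
            ext a; simp [and_comm]
          rw [this, Finset.card_sdiff_of_subset hC]; simp
        · simp only [Prod.mk.injEq, decide_eq_false_iff_not, decide_eq_true_eq]
          have : (univ.filter fun a => a ∈ C ∧ a ∉ B) = ∅ := by
            ext a; simp; exact fun h => hC h
          rw [this]; simp
        · simp only [Prod.mk.injEq, decide_eq_true_eq]
          have : (univ.filter fun a => a ∈ C ∧ a ∈ B) = C := by
            ext a; simp; exact fun h => hC h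
          rw [this]; simp
      rw [e1 A hA, e1 A' hA', hc])
  have h1 : ∀ a, (σ a ∈ A' ↔ a ∈ A) ∧ (σ a ∈ B ↔ a ∈ B) := by
    intro a
    have := hσ a
    simpa using this
  refine ⟨σ, ?_, ?_⟩
  · apply Finset.eq_of_subset_of_card_le
    · intro b hb
      obtain ⟨a, ha, rfl⟩ := Finset.mem_image.mp hb
      exact (h1 a).1.mpr ha
    · rw [Finset.card_image_of_injective _ σ.injective, hc]
  · apply Finset.eq_of_subset_of_card_le
    · intro b hb
      obtain ⟨a, ha, rfl⟩ := Finset.mem_image.mp hb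
      exact (h1 a).2.mpr ha
    · rw [Finset.card_image_of_injective _ σ.injective]

/-- Proportion of chains through a set. -/
lemma count_one {n : ℕ} (A : Finset (Fin n)) :
    #{π : Equiv.Perm (Fin n) | pre π #A = A} * n.choose #A = n.factorial := by
  have hn : #A ≤ n := by simpa using Finset.card_le_univ A
  have := unif_count (fun π : Equiv.Perm (Fin n) => pre π #A) (Finset.powersetCard #A univ) (by
    intro y hy y' hy'
    rw [Finset.mem_powersetCard] at hy hy'
    obtain ⟨σ, h1, -⟩ := exists_perm_sets y y' univ (by simp) (by simp) (hy.2.trans hy'.2.symm)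
    refine ⟨σ, fun π => ?_⟩
    simp only [pre_mul]
    rw [← h1]
    exact ⟨fun h => by rw [h], fun h => Finset.image_injective σ.injective h⟩) A
    (by simp [Finset.mem_powersetCard])
  rw [Finset.card_powersetCard, Finset.card_univ, Fintype.card_fin] at this
  rw [this]
  rw [Finset.filter_true_of_mem]
  · rw [Finset.card_univ, Fintype.card_perm, Fintype.card_fin]
  · intro π _
    simp [Finset.mem_powersetCard, card_pre π hn]

/-- Proportion of chains through two nested sets. -/
lemma count_two {n : ℕ} (A B : Finset (Fin n)) (hAB : A ⊆ B) :
    #{π : Equiv.Perm (Fin n) | pre π #A = A ∧ pre π #B = B} * (#B).choose #A =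
      #{π : Equiv.Perm (Fin n) | pre π #B = B} := by
  have hn : #B ≤ n := by simpa using Finset.card_le_univ B
  have hab := Finset.card_le_card hAB
  have := unif_count (fun π : Equiv.Perm (Fin n) => (pre π #A, pre π #B))
    ((Finset.powersetCard #A B) ×ˢ {B}) (by
    rintro ⟨y, z⟩ hy ⟨y', z'⟩ hy'
    simp only [Finset.mem_product, Finset.mem_powersetCard, Finset.mem_singleton] at hy hy'
    obtain ⟨hy, rfl⟩ := hy
    obtain ⟨hy', rfl⟩ := hy'
    obtain ⟨σ, h1, h2⟩ := exists_perm_sets y y' z' hy.1 hy'.1 (hy.2.trans hy'.2.symm)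
    refine ⟨σ, fun π => ?_⟩
    simp only [pre_mul, Prod.mk.injEq]
    have inj := Finset.image_injective σ.injective
    constructor
    · rintro ⟨h3, h4⟩; rw [h3, h4]; exact ⟨h1, h2⟩
    · rintro ⟨h3, h4⟩
      exact ⟨inj (h3.trans h1.symm), inj (h4.trans h2.symm)⟩) (A, B)
    (by simp [Finset.mem_powersetCard, hAB])
  rw [Finset.card_product, Finset.card_powersetCard, Finset.card_singleton, mul_one] at this
  simp only [Prod.mk.injEq, Finset.mem_product, Finset.mem_powersetCard,
    Finset.mem_singleton] at this
  rw [this]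
  congr 1
  ext π
  simp only [Finset.mem_filter, Finset.mem_univ, true_and]
  constructor
  · exact fun h => h.2
  · intro h
    refine ⟨⟨?_, card_pre π (hab.trans hn)⟩, h⟩
    conv_rhs => rw [← h]
    exact pre_mono π hab

/-- The first four elements. -/
def first4 {n : ℕ} (hn : 4 ≤ n) (π : Equiv.Perm (Fin n)) : Fin 4 → Fin n :=
  fun i => π (Fin.castLE hn i)

lemma first4_injective {n : ℕ} (hn : 4 ≤ n) (π : Equiv.Perm (Fin n)) :
    Function.Injective (first4 hn π) :=
  π.injective.comp (Fin.castLE_injective hn)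

/-- The injective quadruples. -/
def injs (n : ℕ) : Finset (Fin 4 → Fin n) := univ.filter Function.Injective

lemma card_injs (n : ℕ) : #(injs n) = n.descFactorial 4 := by
  rw [injs, ← Fintype.card_subtype,
    Fintype.card_congr (Equiv.subtypeInjectiveEquivEmbedding (Fin 4) (Fin n)),
    Fintype.card_embedding_eq]
  simp

lemma count_first4 {n : ℕ} (hn : 4 ≤ n) (t : Fin 4 → Fin n) (ht : t ∈ injs n) :
    #{π : Equiv.Perm (Fin n) | first4 hn π = t} * n.descFactorial 4 = n.factorial := by
  classical
  have := unif_count (first4 hn) (injs n) (by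
    intro y hy y' hy'
    simp only [injs, Finset.mem_filter, Finset.mem_univ, true_and] at hy hy'
    have hex : ∃ σ : Equiv.Perm (Fin n), ∀ i, σ (y i) = y' i := by
      let g : Set.range y ≃ Set.range y' :=
        (Equiv.ofInjective y hy).symm.trans (Equiv.ofInjective y' hy')
      refine ⟨g.extendSubtype, fun i => ?_⟩
      rw [Equiv.extendSubtype_apply_of_mem g (y i) ⟨i, rfl⟩]
      have : (Equiv.ofInjective y hy).symm ⟨y i, ⟨i, rfl⟩⟩ = i := by
        rw [Equiv.symm_apply_eq]; rfl
      simp only [g, Equiv.trans_apply, this]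
      rfl
    obtain ⟨σ, hσ⟩ := hex
    refine ⟨σ, fun π => ?_⟩
    constructor
    · rintro rfl
      funext i
      exact hσ i
    · intro h
      funext i
      have h2 : σ (π (Fin.castLE hn i)) = y' i := congrFun h i
      rw [← hσ i] at h2
      exact σ.injective h2) t ht
  rw [card_injs] at this
  rw [this, Finset.filter_true_of_mem]
  · rw [Finset.card_univ, Fintype.card_perm, Fintype.card_fin]
  · intro π _
    simp [injs, first4_injective]

lemma sum_first4 {n : ℕ} (hn : 4 ≤ n) (h : (Fin 4 → Fin n) → ℝ) :
    (∑ π : Equiv.Perm (Fin n), h (first4 hn π)) * (n.descFactorial 4 : ℝ) =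
      (n.factorial : ℝ) * ∑ t ∈ injs n, h t := by
  have h1 : (∑ π : Equiv.Perm (Fin n), h (first4 hn π)) =
      ∑ t ∈ injs n, ∑ π ∈ univ.filter (fun π => first4 hn π = t), h (first4 hn π) := by
    rw [Finset.sum_fiberwise_of_maps_to]
    intro π _
    simp [injs, first4_injective]
  rw [h1, Finset.sum_mul, Finset.mul_sum]
  refine Finset.sum_congr rfl fun t ht => ?_
  rw [Finset.sum_congr rfl (g := fun _ => h t)]
  · rw [Finset.sum_const, nsmul_eq_mul]
    have := count_first4 hn t ht
    have h2 : (#{π : Equiv.Perm (Fin n) | first4 hn π = t} : ℝ) * (n.descFactorial 4 : ℝ)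
      = n.factorial := by exact_mod_cast this
    rw [← h2]; ring
  · intro π hπ
    rw [(Finset.mem_filter.mp hπ).2]

/-! ### The sum-of-squares bound over quadruples -/

/-- Four-tuples as functions. -/
def quadEquiv (α : Type*) : (Fin 4 → α) ≃ (α × α) × (α × α) where
  toFun t := ((t 0, t 1), (t 2, t 3))
  invFun p := ![p.1.1, p.1.2, p.2.1, p.2.2]
  left_inv t := by
    funext i
    fin_cases i <;> rfl
  right_inv p := rfl

section quad
variable {n : ℕ} (X : Fin n → Bool) (E : Fin n → Fin n → Bool)

/-- The chain value of a quadruple. -/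
def quadVal (t : Fin 4 → Fin n) : ℕ :=
  chainVal (X (t 0)) (X (t 1)) (X (t 2)) (X (t 3)) (E (t 0) (t 1)) (E (t 0) (t 2)) (E (t 0) (t 3))
    (E (t 1) (t 2)) (E (t 1) (t 3)) (E (t 2) (t 3))

/-- The linear form at a triple of vertices. -/
def sosAt (u v w : Fin n) : ℤ := sosForm (X u) (X v) (X w) (E u v) (E u w) (E v w)

/-- The certificate at a quadruple. -/
def quadCert (t : Fin 4 → Fin n) : ℤ :=
  certAt (fun i => X (t i)) (fun i j => E (t i) (t j)) 0 1 2 3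

lemma quadCert_eq (t : Fin 4 → Fin n) :
    quadCert X E t = 9 * (quadVal X E t : ℤ)
      + sosAt X E (t 0) (t 1) (t 2) * sosAt X E (t 0) (t 1) (t 3) := rfl

lemma sum_list_swap {ι β : Type*} (s : Finset ι) (l : List β) (g : ι → β → ℤ) :
    ∑ t ∈ s, (l.map (g t)).sum = (l.map fun p => ∑ t ∈ s, g t p).sum := by
  induction l with
  | nil => simp
  | cons a l ih => simp [Finset.sum_add_distrib, ih]

lemma sum_injs_comp (h : (Fin 4 → Fin n) → ℤ) (p : Fin 4 → Fin 4) (hp : Function.Bijective p) :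
    ∑ t ∈ injs n, h (t ∘ p) = ∑ t ∈ injs n, h t := by
  refine Finset.sum_equiv (Equiv.arrowCongr (Equiv.ofBijective p hp).symm (Equiv.refl _)) ?_ ?_
  · intro t
    simp only [injs, Finset.mem_filter, Finset.mem_univ, true_and]
    have : (Equiv.arrowCongr (Equiv.ofBijective p hp).symm (Equiv.refl (Fin n))) t = t ∘ p := by
      funext i; simp [Equiv.arrowCongr]
    rw [this]
    constructor
    · exact fun h => h.comp hp.1
    · intro h
      exact (Function.Injective.of_comp_iff' t hp).mp h
  · intro t _
    congr 1

lemma sos_nonneg : 0 ≤ ∑ t : Fin 4 → Fin n,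
    sosAt X E (t 0) (t 1) (t 2) * sosAt X E (t 0) (t 1) (t 3) := by
  have key := Fintype.sum_equiv (quadEquiv (Fin n))
    (fun t => sosAt X E (t 0) (t 1) (t 2) * sosAt X E (t 0) (t 1) (t 3))
    (fun p => sosAt X E p.1.1 p.1.2 p.2.1 * sosAt X E p.1.1 p.1.2 p.2.2) (fun t => rfl)
  rw [key, Fintype.sum_prod_type]
  refine Finset.sum_nonneg fun p _ => ?_
  rw [Fintype.sum_prod_type]
  simp only
  have : (∑ x, ∑ y, sosAt X E p.1 p.2 x * sosAt X E p.1 p.2 y)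
      = (∑ x, sosAt X E p.1 p.2 x) * (∑ x, sosAt X E p.1 p.2 x) := by
    rw [Finset.sum_mul_sum]
  rw [this]
  exact mul_self_nonneg _

lemma quad_bound (hE : ∀ u v, E u v = E v u)
    (hX : ∀ u v, u ≠ v → (X u && X v && E u v) = false) :
    24 * (9 * ∑ t ∈ injs n, (quadVal X E t : ℤ)) ≤
      3280 * (n.descFactorial 4 : ℤ) + 2904 * ((n : ℤ) ^ 4 - n.descFactorial 4) := by
  have hcert : 24 * ∑ t ∈ injs n, quadCert X E t ≤ 3280 * (n.descFactorial 4 : ℤ) := by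
    have h1 : (perms4.map fun p => ∑ t ∈ injs n, quadCert X E (t ∘ p)).sum
        = 24 * ∑ t ∈ injs n, quadCert X E t := by
      rw [List.sum_eq_card_nsmul _ (∑ t ∈ injs n, quadCert X E t)]
      · simp [perms4_length]
      · intro z hz
        obtain ⟨p, hp, rfl⟩ := List.mem_map.mp hz
        exact sum_injs_comp _ p (perms4_bij p hp)
    rw [← h1, ← sum_list_swap, ← card_injs, mul_comm, ← nsmul_eq_mul]
    refine Finset.sum_le_card_nsmul _ _ _ fun t ht => ?_
    have hinj : Function.Injective t := by simpa [injs] using ht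
    have h2 := certAt_sum (fun i => X (t i)) (fun i j => E (t i) (t j)) (fun i j => hE _ _)
    have h3 : (perms4.map fun p => quadCert X E (t ∘ p)) = (perms4.map fun p =>
      certAt (fun i => X (t i)) (fun i j => E (t i) (t j)) (p 0) (p 1) (p 2) (p 3)) := rfl
    rw [h3, h2]
    apply certSum_le
    have h4 : ∀ i j, i ≠ j → (X (t i) && X (t j) && E (t i) (t j)) = false :=
      fun i j hij => hX _ _ (fun h => hij (hinj h))
    rw [h4 0 1 (by decide), h4 0 2 (by decide), h4 0 3 (by decide), h4 1 2 (by decide),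
      h4 1 3 (by decide), h4 2 3 (by decide)]
    rfl
  have hsq := sos_nonneg X E
  have hsplit := Finset.sum_filter_add_sum_filter_not (univ : Finset (Fin 4 → Fin n))
    Function.Injective
    (fun t => sosAt X E (t 0) (t 1) (t 2) * sosAt X E (t 0) (t 1) (t 3))
  have hnon : ∑ t ∈ univ.filter (fun t : Fin 4 → Fin n => ¬ Function.Injective t),
      sosAt X E (t 0) (t 1) (t 2) * sosAt X E (t 0) (t 1) (t 3) ≤
      121 * ((n : ℤ) ^ 4 - n.descFactorial 4) := by
    have hc : ((#(univ.filter (fun t : Fin 4 → Fin n => ¬ Function.Injective t)) : ℕ) : ℤ)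
        = (n : ℤ) ^ 4 - n.descFactorial 4 := by
      have := Finset.card_filter_add_card_filter_not (s := (univ : Finset (Fin 4 → Fin n)))
        Function.Injective
      have h5 := card_injs n
      rw [injs] at h5
      rw [h5] at this
      simp only [Finset.card_univ, Fintype.card_pi, Fintype.card_fin, Finset.prod_const] at this
      have h6 : ((n.descFactorial 4 : ℕ) : ℤ) +
        (#(univ.filter (fun t : Fin 4 → Fin n => ¬ Function.Injective t)) : ℕ) = (n : ℤ) ^ 4 := by
        exact_mod_cast this
      linarith
    rw [← hc, mul_comm, ← nsmul_eq_mul]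
    refine Finset.sum_le_card_nsmul _ _ _ fun t _ => ?_
    have b1 := sosForm_bound (X (t 0)) (X (t 1)) (X (t 2)) (E (t 0) (t 1)) (E (t 0) (t 2))
      (E (t 1) (t 2))
    have b2 := sosForm_bound (X (t 0)) (X (t 1)) (X (t 3)) (E (t 0) (t 1)) (E (t 0) (t 3))
      (E (t 1) (t 3))
    change sosForm _ _ _ _ _ _ * sosForm _ _ _ _ _ _ ≤ 121
    nlinarith [b1.1, b1.2, b2.1, b2.2]
  have hsum : ∑ t ∈ injs n, quadCert X E t = 9 * ∑ t ∈ injs n, (quadVal X E t : ℤ) +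
      ∑ t ∈ injs n, sosAt X E (t 0) (t 1) (t 2) * sosAt X E (t 0) (t 1) (t 3) := by
    simp only [quadCert_eq, Finset.sum_add_distrib, Finset.mul_sum]
  rw [hsum] at hcert
  change ∑ t ∈ injs n, _ + _ = _ at hsplit
  linarith

end quad

/-! ### The weight of a single chain -/

lemma mem_of_on {n : ℕ} (hn : 4 ≤ n) (π : Equiv.Perm (Fin n)) (B : Finset (Fin n))
    (hB : pre π #B = B) (i : Fin 4) (hi : i.val < #B) : first4 hn π i ∈ B := by
  rw [← hB]
  simp only [pre, first4, Finset.mem_image, Finset.mem_filter, Finset.mem_univ, true_and]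
  exact ⟨Fin.castLE hn i, by simpa using hi, rfl⟩

lemma on_eq_image {n : ℕ} (hn : 4 ≤ n) (π : Equiv.Perm (Fin n)) (B : Finset (Fin n))
    (hB : pre π #B = B) (hb : #B ≤ 4) :
    B = (univ.filter (fun i : Fin 4 => i.val < #B)).image (first4 hn π) := by
  symm
  apply Finset.eq_of_subset_of_card_le
  · intro y hy
    obtain ⟨i, hi, rfl⟩ := Finset.mem_image.mp hy
    exact mem_of_on hn π B hB i (by simpa using hi)
  · rw [Finset.card_image_of_injective _ (first4_injective hn π), Fin.card_filter_val_lt]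
    omega

lemma le_choose (n k : ℕ) (hk : 0 < k) (hkn : k < n) : n ≤ n.choose k := by
  induction n generalizing k with
  | zero => omega
  | succ n ih =>
    obtain ⟨k, rfl⟩ : ∃ j, k = j + 1 := ⟨k - 1, by omega⟩
    rcases Nat.lt_or_ge (k + 1) n with h | h
    · have h1 := ih (k + 1) (by omega) h
      have h2 : 0 < n.choose k := Nat.choose_pos (by omega)
      rw [Nat.choose_succ_succ']
      omega
    · obtain rfl : n = k + 1 := by omega
      simp

section chain
variable {n : ℕ} (G : Finset (Finset (Fin n)))

/-- Which singletons are in the family. -/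
def sX (u : Fin n) : Bool := decide ({u} ∈ G)

/-- Which pairs are in the family. -/
def sE (u v : Fin n) : Bool := decide ({u, v} ∈ G)

lemma sE_symm (u v : Fin n) : sE G u v = sE G v u := by
  simp [sE, Finset.pair_comm]

/-- Every member has at most one proper subset in the family. -/
def OneBelow : Prop := ∀ C ∈ G, ∀ A ∈ G, ∀ B ∈ G, A ⊂ C → B ⊂ C → A = B

lemma sX_sE (hG : OneBelow G) (u v : Fin n) (huv : u ≠ v) : (sX G u && sX G v && sE G u v) = false := by
  by_contra hcon
  simp only [Bool.not_eq_false, Bool.and_eq_true, sX, sE, decide_eq_true_eq] at hcon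
  obtain ⟨⟨h1, h2⟩, h3⟩ := hcon
  have h4 : ∀ w ∈ ({u, v} : Finset (Fin n)), ({w} : Finset (Fin n)) ⊂ {u, v} := by
    intro w hw
    rw [Finset.ssubset_iff_subset_ne]
    refine ⟨by simpa using hw, fun h => ?_⟩
    have := congrArg Finset.card h
    rw [Finset.card_pair huv, Finset.card_singleton] at this
    omega
  have := hG _ h3 _ h1 _ h2 (h4 u (by simp)) (h4 v (by simp))
  exact huv (by simpa using this)

lemma ssubset_of_card_lt {S B : Finset (Fin n)} (h : S ⊆ B) (hc : #S < #B) : S ⊂ B := by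
  rw [Finset.ssubset_iff_subset_ne]
  exact ⟨h, fun h' => by rw [h'] at hc; exact lt_irrefl _ hc⟩

lemma chain_pair (hn : 4 ≤ n) (h0 : ∅ ∉ G) (hG : OneBelow G) (π : Equiv.Perm (Fin n))
    (A B : Finset (Fin n)) (hA : A ∈ G) (hB : B ∈ G) (hAB : A ⊂ B) (hon : pre π #B = B) :
    12 * (1 + 1 / ((#B).choose #A : ℝ)) ≤ quadVal (sX G) (sE G) (first4 hn π) := by
  have hinj := first4_injective hn π
  have hmem := mem_of_on hn π B hon
  have himg := on_eq_image hn π B hon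
  unfold quadVal
  generalize first4 hn π = t at *
  have hcard := Finset.card_lt_card hAB
  have hapos : 0 < #A := by
    rw [Finset.card_pos, Finset.nonempty_iff_ne_empty]
    rintro rfl; exact h0 hA
  have hsX : ∀ i : Fin 4, i.val < #B → sX G (t i) = true → A = {t i} := by
    intro i hi hx
    have h1 : {t i} ∈ G := by simpa [sX] using hx
    refine hG B hB A hA _ h1 hAB (ssubset_of_card_lt (by simpa using hmem i hi) ?_)
    rw [Finset.card_singleton]; omega
  have hsE : 3 ≤ #B → ∀ i j : Fin 4, i.val < #B → j.val < #B → i ≠ j →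
      sE G (t i) (t j) = true → A = {t i, t j} := by
    intro h3 i j hi hj hij hx
    have h1 : {t i, t j} ∈ G := by simpa [sE] using hx
    refine hG B hB A hA _ h1 hAB (ssubset_of_card_lt ?_ ?_)
    · intro y hy
      rcases Finset.mem_insert.mp hy with rfl | hy
      · exact hmem i hi
      · rw [Finset.mem_singleton.mp hy]; exact hmem j hj
    · rw [Finset.card_pair (fun h => hij (hinj h))]; omega
  have hXX : ∀ i j : Fin 4, i.val < #B → j.val < #B → i ≠ j →
      (sX G (t i) && sX G (t j)) = false := by
    intro i j hi hj hij
    by_contra hcon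
    simp only [Bool.not_eq_false, Bool.and_eq_true] at hcon
    have h1 := hsX i hi hcon.1
    have h2 := hsX j hj hcon.2
    rw [h1] at h2
    exact hij (hinj (by simpa using h2))
  have hX0 : #A ≠ 1 → ∀ i : Fin 4, i.val < #B → sX G (t i) = false := by
    intro ha i hi
    by_contra hcon
    have := hsX i hi (by simpa using hcon)
    exact ha (by rw [this]; simp)
  have hE0 : #A ≠ 2 → 3 ≤ #B → ∀ i j : Fin 4, i.val < #B → j.val < #B → i ≠ j →
      sE G (t i) (t j) = false := by
    intro ha h3 i j hi hj hij
    by_contra hcon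
    have := hsE h3 i j hi hj hij (by simpa using hcon)
    exact ha (by rw [this, Finset.card_pair (fun h => hij (hinj h))])
  have hEE : 3 ≤ #B → ∀ i j k l : Fin 4, i.val < #B → j.val < #B → k.val < #B → l.val < #B →
      i ≠ j → k ≠ l → ((i ≠ k ∧ i ≠ l) ∨ (j ≠ k ∧ j ≠ l)) →
      (sE G (t i) (t j) && sE G (t k) (t l)) = false := by
    intro h3 i j k l hi hj hk hl hij hkl hne
    by_contra hcon
    simp only [Bool.not_eq_false, Bool.and_eq_true] at hcon
    have h1 := hsE h3 i j hi hj hij hcon.1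
    have h2 := hsE h3 k l hk hl hkl hcon.2
    rw [h1] at h2
    rcases hne with hne | hne
    · have : t i ∈ ({t k, t l} : Finset (Fin n)) := by rw [← h2]; simp
      simp only [Finset.mem_insert, Finset.mem_singleton] at this
      rcases this with h | h
      · exact hne.1 (hinj h)
      · exact hne.2 (hinj h)
    · have : t j ∈ ({t k, t l} : Finset (Fin n)) := by rw [← h2]; simp
      simp only [Finset.mem_insert, Finset.mem_singleton] at this
      rcases this with h | h
      · exact hne.1 (hinj h)
      · exact hne.2 (hinj h)
  rcases (show #B = 2 ∨ #B = 3 ∨ 4 ≤ #B by omega) with hb | hb | hb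
  · -- two elements
    have ha : #A = 1 := by omega
    have himg2 := himg (by omega)
    have hs : univ.filter (fun i : Fin 4 => i.val < 2) = {0, 1} := by decide
    rw [hb, hs] at himg2
    simp only [Finset.image_insert, Finset.image_singleton] at himg2
    have e1 : sE G (t 0) (t 1) = true := by simp [sE, ← himg2, hB]
    obtain ⟨y, rfl⟩ := Finset.card_eq_one.mp ha
    have hy : y ∈ B := hAB.1 (by simp)
    rw [himg2] at hy
    simp only [Finset.mem_insert, Finset.mem_singleton] at hy
    have e2 : (sX G (t 0) || sX G (t 1)) = true := by
      rcases hy with rfl | rfl <;> simp [sX, hA]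
    rw [chainVal_ge_two e1 e2 (hXX 0 1 (by rw [hb]; decide) (by rw [hb]; decide) (by decide)), hb, ha]
    norm_num
  · have himg2 := himg (by omega)
    have hs : univ.filter (fun i : Fin 4 => i.val < 3) = {0, 1, 2} := by decide
    rw [hb, hs] at himg2
    simp only [Finset.image_insert, Finset.image_singleton] at himg2
    have l0 : (0 : Fin 4).val < #B := by rw [hb]; decide
    have l1 : (1 : Fin 4).val < #B := by rw [hb]; decide
    have l2 : (2 : Fin 4).val < #B := by rw [hb]; decide
    rcases (show #A = 1 ∨ #A = 2 by omega) with ha | ha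
    · have hE0' := hE0 (by omega) (by omega)
      obtain ⟨y, rfl⟩ := Finset.card_eq_one.mp ha
      have hy : y ∈ B := hAB.1 (by simp)
      rw [himg2] at hy
      simp only [Finset.mem_insert, Finset.mem_singleton] at hy
      have e2 : (sX G (t 0) || sX G (t 1) || sX G (t 2)) = true := by
        rcases hy with rfl | rfl | rfl <;> simp [sX, hA]
      rw [chainVal_three_single e2 (hXX 0 1 l0 l1 (by decide)) (hXX 0 2 l0 l2 (by decide))
        (hXX 1 2 l1 l2 (by decide)) (hE0' 0 1 l0 l1 (by decide)) (hE0' 0 2 l0 l2 (by decide))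
        (hE0' 1 2 l1 l2 (by decide)), hb, ha]
      norm_num
    · have hX0' := hX0 (by omega)
      obtain ⟨y, z, hyz, rfl⟩ := Finset.card_eq_two.mp ha
      have hy : y ∈ B := hAB.1 (by simp)
      have hz : z ∈ B := hAB.1 (by simp)
      rw [himg2] at hy hz
      simp only [Finset.mem_insert, Finset.mem_singleton] at hy hz
      have hA' := hA
      rw [Finset.pair_comm] at hA'
      have e2 : (sE G (t 0) (t 1) || sE G (t 0) (t 2) || sE G (t 1) (t 2)) = true := by
        rcases hy with rfl | rfl | rfl <;> rcases hz with rfl | rfl | rfl <;>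
          first | exact absurd rfl hyz | (simp [sE, hA]; done) | simp [sE, hA']
      have h3 : 3 ≤ #B := by omega
      rw [chainVal_three_pair e2
        (hEE h3 0 1 0 2 l0 l1 l0 l2 (by decide) (by decide) (by decide))
        (hEE h3 0 1 1 2 l0 l1 l1 l2 (by decide) (by decide) (by decide))
        (hEE h3 0 2 1 2 l0 l2 l1 l2 (by decide) (by decide) (by decide))
        (hX0' 0 l0) (hX0' 1 l1) (hX0' 2 l2), hb, ha]
      norm_num
  · have lt : ∀ i : Fin 4, i.val < #B := fun i => by omega
    have h3 : 3 ≤ #B := by omega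
    by_cases ha2 : #A = 2
    · have hX0' := hX0 (by omega)
      have key := chainVal_four_pair (x0 := sX G (t 0)) (x1 := sX G (t 1)) (x2 := sX G (t 2))
        (x3 := sX G (t 3)) (hX0' 0 (lt _)) (hX0' 1 (lt _)) (hX0' 2 (lt _)) (hX0' 3 (lt _))
        (hEE h3 0 1 0 2 (lt _) (lt _) (lt _) (lt _) (by decide) (by decide) (by decide))
        (hEE h3 0 1 1 2 (lt _) (lt _) (lt _) (lt _) (by decide) (by decide) (by decide))
        (hEE h3 0 2 1 2 (lt _) (lt _) (lt _) (lt _) (by decide) (by decide) (by decide))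
        (hEE h3 0 3 1 3 (lt _) (lt _) (lt _) (lt _) (by decide) (by decide) (by decide))
        (hEE h3 0 3 2 3 (lt _) (lt _) (lt _) (lt _) (by decide) (by decide) (by decide))
        (hEE h3 1 3 2 3 (lt _) (lt _) (lt _) (lt _) (by decide) (by decide) (by decide))
      have hc : 6 ≤ (#B).choose #A := by
        rw [ha2]
        calc 6 = Nat.choose 4 2 := by decide
          _ ≤ _ := Nat.choose_le_choose 2 hb
      have hc' : (6 : ℝ) ≤ ((#B).choose #A : ℝ) := by exact_mod_cast hc
      refine le_trans ?_ (Nat.cast_le.mpr key)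
      have : 1 / ((#B).choose #A : ℝ) ≤ 1 / 6 := one_div_le_one_div_of_le (by norm_num) hc'
      push_cast
      linarith
    · have hE0' := hE0 ha2 h3
      have key := chainVal_four_single (x3 := sX G (t 3)) (hXX 0 1 (lt _) (lt _) (by decide))
        (hXX 0 2 (lt _) (lt _) (by decide)) (hXX 1 2 (lt _) (lt _) (by decide))
        (hE0' 0 1 (lt _) (lt _) (by decide)) (hE0' 0 2 (lt _) (lt _) (by decide))
        (hE0' 1 2 (lt _) (lt _) (by decide)) (hE0' 0 3 (lt _) (lt _) (by decide))
        (hE0' 1 3 (lt _) (lt _) (by decide)) (hE0' 2 3 (lt _) (lt _) (by decide))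
      have hc : 4 ≤ (#B).choose #A := by
        have h5 : #B ≤ (#B).choose #A := le_choose _ _ hapos hcard
        omega
      have hc' : (4 : ℝ) ≤ ((#B).choose #A : ℝ) := by exact_mod_cast hc
      refine le_trans ?_ (Nat.cast_le.mpr key)
      have : 1 / ((#B).choose #A : ℝ) ≤ 1 / 4 := one_div_le_one_div_of_le (by norm_num) hc'
      push_cast
      linarith

lemma chain_hit (hn : 4 ≤ n) (h0 : ∅ ∉ G) (hG : OneBelow G) (π : Equiv.Perm (Fin n))
    (B : Finset (Fin n)) (hB : B ∈ G) (hon : pre π #B = B) :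
    12 ≤ quadVal (sX G) (sE G) (first4 hn π) := by
  by_contra hcon
  have hinj := first4_injective hn π
  have hmem := mem_of_on hn π B hon
  have himg := on_eq_image hn π B hon
  unfold quadVal at hcon
  generalize first4 hn π = t at *
  obtain ⟨hx0, he01, hor⟩ := chainVal_zero (not_le.mp hcon)
  have hpos : 0 < #B := by
    rw [Finset.card_pos, Finset.nonempty_iff_ne_empty]
    rintro rfl; exact h0 hB
  rcases (show #B = 1 ∨ #B = 2 ∨ 3 ≤ #B by omega) with hb | hb | hb
  · have himg2 := himg (by omega)
    have hs : univ.filter (fun i : Fin 4 => i.val < 1) = {0} := by decide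
    rw [hb, hs] at himg2
    simp only [Finset.image_singleton] at himg2
    rw [himg2] at hB
    simp [sX, hB] at hx0
  · have himg2 := himg (by omega)
    have hs : univ.filter (fun i : Fin 4 => i.val < 2) = {0, 1} := by decide
    rw [hb, hs] at himg2
    simp only [Finset.image_insert, Finset.image_singleton] at himg2
    rw [himg2] at hB
    simp [sE, hB] at he01
  · have m0 : t 0 ∈ B := hmem 0 (lt_of_lt_of_le (by decide) hb)
    have m1 : t 1 ∈ B := hmem 1 (lt_of_lt_of_le (by decide) hb)
    have m2 : t 2 ∈ B := hmem 2 (lt_of_lt_of_le (by decide) hb)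
    have n01 : t 0 ≠ t 1 := fun h => absurd (hinj h) (by decide)
    have n02 : t 0 ≠ t 2 := fun h => absurd (hinj h) (by decide)
    have n12 : t 1 ≠ t 2 := fun h => absurd (hinj h) (by decide)
    have hX : ∀ u ∈ B, ({u} : Finset (Fin n)) ⊂ B := by
      intro u hu
      exact ssubset_of_card_lt (by simpa using hu) (by rw [Finset.card_singleton]; omega)
    have hE : ∀ u ∈ B, ∀ v ∈ B, u ≠ v → ({u, v} : Finset (Fin n)) ⊂ B := by
      intro u hu v hv huv
      refine ssubset_of_card_lt ?_ (by rw [Finset.card_pair huv]; omega)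
      intro y hy
      rcases Finset.mem_insert.mp hy with rfl | hy
      · exact hu
      · rw [Finset.mem_singleton.mp hy]; exact hv
    have hXE : ∀ u ∈ B, ∀ v ∈ B, ∀ w ∈ B, v ≠ w → {u} ∈ G → {v, w} ∈ G → False := by
      intro u hu v hv w hw hvw h1 h2
      have := hG B hB _ h1 _ h2 (hX u hu) (hE v hv w hw hvw)
      have := congrArg Finset.card this
      rw [Finset.card_pair hvw, Finset.card_singleton] at this
      omega
    simp only [Bool.or_eq_true, Bool.and_eq_true, sX, sE, decide_eq_true_eq] at hor
    rcases hor with ((((h | h) | h) | h) | h) | h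
    · have := hG B hB _ h.1 _ h.2 (hX _ m1) (hX _ m2)
      exact n12 (by simpa using this)
    · exact hXE _ m1 _ m1 _ m2 n12 h.1 h.2
    · exact hXE _ m1 _ m0 _ m2 n02 h.1 h.2
    · exact hXE _ m2 _ m0 _ m2 n02 h.1 h.2
    · exact hXE _ m2 _ m1 _ m2 n12 h.1 h.2
    · have := hG B hB _ h.1 _ h.2 (hE _ m0 _ m2 n02) (hE _ m1 _ m2 n12)
      have h5 : t 0 ∈ ({t 1, t 2} : Finset (Fin n)) := by rw [← this]; simp
      simp only [Finset.mem_insert, Finset.mem_singleton] at h5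
      rcases h5 with h5 | h5
      · exact n01 h5
      · exact n02 h5

/-- The comparable pairs of the family. -/
def cPairs : Finset (Finset (Fin n) × Finset (Fin n)) := (G ×ˢ G).filter fun p => p.1 ⊂ p.2

lemma mem_cPairs (A B : Finset (Fin n)) : (A, B) ∈ cPairs G ↔ (A ∈ G ∧ B ∈ G) ∧ A ⊂ B := by
  simp [cPairs]

lemma on_chain (π : Equiv.Perm (Fin n)) (B B' : Finset (Fin n)) (h : pre π #B = B)
    (h' : pre π #B' = B') (hc : #B ≤ #B') : B ⊆ B' := by
  rw [← h, ← h']; exact pre_mono π hc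

lemma chain_weight (hn : 4 ≤ n) (h0 : ∅ ∉ G) (hG : OneBelow G) (π : Equiv.Perm (Fin n)) :
    12 * ((if ∃ B ∈ G, pre π #B = B then (1 : ℝ) else 0) +
      ∑ p ∈ cPairs G, if pre π #p.2 = p.2 then 1 / ((#p.2).choose #p.1 : ℝ) else 0) ≤
    quadVal (sX G) (sE G) (first4 hn π) := by
  by_cases hex : ∃ p ∈ cPairs G, pre π #p.2 = p.2
  · obtain ⟨⟨A, B⟩, hp, hon⟩ := hex
    obtain ⟨⟨hA, hB⟩, hAB⟩ := (mem_cPairs G A B).mp hp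
    simp only at hon
    rw [Finset.sum_eq_single (A, B)]
    · rw [if_pos ⟨B, hB, hon⟩, if_pos hon]
      exact chain_pair G hn h0 hG π A B hA hB hAB hon
    · rintro ⟨A', B'⟩ hp' hne
      obtain ⟨⟨hA', hB'⟩, hAB'⟩ := (mem_cPairs G A' B').mp hp'
      refine if_neg ?_
      intro hon'
      simp only at hon'
      rcases lt_trichotomy #B #B' with h | h | h
      · have h1 := ssubset_of_card_lt (on_chain π B B' hon hon' h.le) h
        have := hG B' hB' A hA B hB (hAB.trans h1) h1
        exact hAB.ne this
      · have h1 : B = B' := by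
          rw [← hon, ← hon', h]
        subst h1
        have := hG B hB A hA A' hA' hAB hAB'
        exact hne (by rw [this])
      · have h1 := ssubset_of_card_lt (on_chain π B' B hon' hon h.le) h
        have := hG B hB A' hA' B' hB' (hAB'.trans h1) h1
        exact hAB'.ne this
    · exact fun h => absurd hp h
  · push Not at hex
    rw [Finset.sum_eq_zero (fun p hp => if_neg (hex p hp)), add_zero]
    split_ifs with h
    · obtain ⟨B, hB, hon⟩ := h
      have := chain_hit G hn h0 hG π B hB hon
      rw [mul_one]
      exact_mod_cast this
    · simp

lemma hits_le (π : Equiv.Perm (Fin n)) :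
    (∑ A ∈ G, if pre π #A = A then (1 : ℝ) else 0) ≤
      (if ∃ B ∈ G, pre π #B = B then (1 : ℝ) else 0) +
      ∑ p ∈ cPairs G, if pre π #p.1 = p.1 ∧ pre π #p.2 = p.2 then (1 : ℝ) else 0 := by
  rw [Finset.sum_boole, Finset.sum_boole]
  split_ifs with h
  · have hne : (G.filter fun A => pre π #A = A).Nonempty := by
      obtain ⟨B, hB, hon⟩ := h
      exact ⟨B, by simp [hB, hon]⟩
    obtain ⟨M, hM, hmin⟩ := Finset.exists_min_image _ Finset.card hne
    have hle : #((G.filter fun A => pre π #A = A).erase M) ≤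
        #((cPairs G).filter fun p => pre π #p.1 = p.1 ∧ pre π #p.2 = p.2) := by
      refine Finset.card_le_card_of_injOn (fun B => (M, B)) ?_ ?_
      · intro B hB
        obtain ⟨hne', hB⟩ := Finset.mem_erase.mp hB
        have h1 := hmin B hB
        rw [Finset.mem_filter] at hB hM
        have h2 := on_chain π M B hM.2 hB.2 h1
        simp only [Finset.coe_filter, Set.mem_ofPred_eq, mem_cPairs]
        exact ⟨⟨⟨hM.1, hB.1⟩, Finset.ssubset_iff_subset_ne.mpr ⟨h2, hne'.symm⟩⟩, hM.2, hB.2⟩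
      · intro B _ B' _ h
        simpa using h
    rw [Finset.card_erase_of_mem hM] at hle
    have : #(G.filter fun A => pre π #A = A) ≤ 1 +
      #((cPairs G).filter fun p => pre π #p.1 = p.1 ∧ pre π #p.2 = p.2) := by omega
    exact_mod_cast this
  · push Not at h
    rw [Finset.filter_false_of_mem h]
    simp

/-- The Lubell mass of a family without empty set in which every member contains at most one
other member. -/
lemma lubell_le (hn : 2000 ≤ n) (h0 : ∅ ∉ G) (hG : OneBelow G) :
    ∑ A ∈ G, 1 / (n.choose #A : ℝ) ≤ 14 / 11 := by
  have hn4 : 4 ≤ n := by omega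
  have hfac : (0 : ℝ) < n.factorial := by exact_mod_cast n.factorial_pos
  have h1 : ∑ π : Equiv.Perm (Fin n), ∑ A ∈ G, (if pre π #A = A then (1 : ℝ) else 0) =
      n.factorial * ∑ A ∈ G, 1 / (n.choose #A : ℝ) := by
    rw [Finset.sum_comm, Finset.mul_sum]
    refine Finset.sum_congr rfl fun A _ => ?_
    rw [Finset.sum_boole]
    have hc := count_one A
    have hA : #A ≤ n := by simpa using Finset.card_le_univ A
    have hpos : (0 : ℝ) < n.choose #A := by exact_mod_cast Nat.choose_pos hA
    rw [mul_one_div, eq_div_iff hpos.ne']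
    exact_mod_cast hc
  have h2 : ∑ π : Equiv.Perm (Fin n), ∑ p ∈ cPairs G,
        (if pre π #p.1 = p.1 ∧ pre π #p.2 = p.2 then (1 : ℝ) else 0) =
      ∑ π : Equiv.Perm (Fin n), ∑ p ∈ cPairs G,
        (if pre π #p.2 = p.2 then 1 / ((#p.2).choose #p.1 : ℝ) else 0) := by
    rw [Finset.sum_comm, Finset.sum_comm (s := (univ : Finset (Equiv.Perm (Fin n))))]
    refine Finset.sum_congr rfl ?_
    rintro ⟨A, B⟩ hp
    obtain ⟨-, hAB⟩ := (mem_cPairs G A B).mp hp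
    have hc := count_two A B hAB.1
    have hpos : (0 : ℝ) < (#B).choose #A := by
      exact_mod_cast Nat.choose_pos (Finset.card_le_card hAB.1)
    rw [Finset.sum_boole, ← Finset.sum_filter, Finset.sum_const, nsmul_eq_mul, mul_one_div,
      eq_div_iff hpos.ne']
    exact_mod_cast hc
  have h3 : 12 * ∑ π : Equiv.Perm (Fin n), ∑ A ∈ G, (if pre π #A = A then (1 : ℝ) else 0) ≤
      ∑ π : Equiv.Perm (Fin n), (quadVal (sX G) (sE G) (first4 hn4 π) : ℝ) := by
    calc 12 * ∑ π : Equiv.Perm (Fin n), ∑ A ∈ G, (if pre π #A = A then (1 : ℝ) else 0)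
        ≤ 12 * ∑ π : Equiv.Perm (Fin n), ((if ∃ B ∈ G, pre π #B = B then (1 : ℝ) else 0) +
          ∑ p ∈ cPairs G, if pre π #p.1 = p.1 ∧ pre π #p.2 = p.2 then (1 : ℝ) else 0) := by
          gcongr with π _
          exact hits_le G π
      _ = ∑ π : Equiv.Perm (Fin n), 12 * ((if ∃ B ∈ G, pre π #B = B then (1 : ℝ) else 0) +
          ∑ p ∈ cPairs G, if pre π #p.2 = p.2 then 1 / ((#p.2).choose #p.1 : ℝ) else 0) := by
          rw [← Finset.mul_sum, Finset.sum_add_distrib, Finset.sum_add_distrib, h2]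
      _ ≤ _ := Finset.sum_le_sum fun π _ => chain_weight G hn4 h0 hG π
  have h4 := sum_first4 hn4 (fun t => (quadVal (sX G) (sE G) t : ℝ))
  have h5 := quad_bound (sX G) (sE G) (sE_symm G) (sX_sE G hG)
  have h6 : 24 * (9 * ∑ t ∈ injs n, (quadVal (sX G) (sE G) t : ℝ)) ≤
      3280 * (n.descFactorial 4 : ℝ) + 2904 * ((n : ℝ) ^ 4 - n.descFactorial 4) := by
    exact_mod_cast h5
  have hd : (n.descFactorial 4 : ℝ) = n * (n - 1) * (n - 2) * (n - 3) := by
    obtain ⟨m, rfl⟩ : ∃ m, n = m + 3 := ⟨n - 3, by omega⟩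
    simp only [Nat.descFactorial_succ, Nat.descFactorial_zero]
    rw [show m + 3 - 3 = m by omega, show m + 3 - 2 = m + 1 by omega,
      show m + 3 - 1 = m + 2 by omega, show m + 3 - 0 = m + 3 by omega]
    push_cast
    ring
  have hnr : (2000 : ℝ) ≤ n := by exact_mod_cast hn
  have hdpos : (0 : ℝ) < n.descFactorial 4 := by
    rw [hd]
    have : (0 : ℝ) < n := by linarith
    have : (0 : ℝ) < n - 1 := by linarith
    have : (0 : ℝ) < n - 2 := by linarith
    have : (0 : ℝ) < n - 3 := by linarith
    positivity
  have h7 : 2904 * ((n : ℝ) ^ 4 - n.descFactorial 4) ≤ 10 * n.descFactorial 4 := by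
    obtain ⟨m, hm⟩ : ∃ m : ℝ, (n : ℝ) = m + 2000 := ⟨n - 2000, by ring⟩
    have hm0 : 0 ≤ m := by linarith
    rw [hd, hm]
    have : 0 ≤ m ^ 4 := by positivity
    have : 0 ≤ m ^ 3 := by positivity
    have : 0 ≤ m ^ 2 := by positivity
    nlinarith
  have h8 : 11 * ∑ t ∈ injs n, (quadVal (sX G) (sE G) t : ℝ) ≤ 12 * 14 * n.descFactorial 4 := by
    linarith
  rw [h1] at h3
  have h9 : 12 * (n.factorial * ∑ A ∈ G, 1 / (n.choose #A : ℝ)) * n.descFactorial 4 ≤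
      n.factorial * ∑ t ∈ injs n, (quadVal (sX G) (sE G) t : ℝ) := by
    rw [← h4]
    exact mul_le_mul_of_nonneg_right h3 hdpos.le
  have h10 : (n.factorial * (n.descFactorial 4 : ℝ)) * (11 * ∑ A ∈ G, 1 / (n.choose #A : ℝ)) ≤
      (n.factorial * (n.descFactorial 4 : ℝ)) * 14 := by
    have := mul_le_mul_of_nonneg_left h8 hfac.le
    linarith
  have := le_of_mul_le_mul_left h10 (mul_pos hfac hdpos)
  linarith

end chain

/-! ### From the cone over a minimal member to arbitrary diamond-free families -/

section cone
variable {N : ℕ} (F : Finset (Finset (Fin N)))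

lemma diamond_ne (hF : DkFree N 2 F) {A B B' C : Finset (Fin N)} (hA : A ∈ F) (hB : B ∈ F)
    (hB' : B' ∈ F) (hC : C ∈ F) (h1 : A ⊂ B) (h2 : A ⊂ B') (h3 : B ⊂ C) (h4 : B' ⊂ C) :
    B = B' := by
  by_contra hne
  apply hF
  refine ⟨A, C, ![B, B'], hA, hC, ?_, ?_, ?_, (h1.trans h3).ne, ?_⟩
  · intro i; fin_cases i
    · exact hB
    · exact hB'
  · intro i j hij
    fin_cases i <;> fin_cases j
    · rfl
    · exact absurd hij hne
    · exact absurd hij.symm hne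
    · rfl
  · intro i; fin_cases i
    · exact ⟨h1.ne', h3.ne⟩
    · exact ⟨h2.ne', h4.ne⟩
  · intro i; fin_cases i
    · exact ⟨h1.1, h3.1⟩
    · exact ⟨h2.1, h4.1⟩

lemma cone_bound (hF : DkFree N 2 F) (S : Finset (Fin N)) (hS : S ∈ F) (m : ℕ)
    (hm : #Sᶜ = m) (hm2 : 2000 ≤ m) :
    ∑ B ∈ F.filter (fun B => S ⊂ B), 1 / (m.choose (#B - #S) : ℝ) ≤ 14 / 11 := by
  classical
  let e := (Sᶜ).orderEmbOfFin hm
  have he : ∀ i, e i ∉ S := fun i => by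
    exact Finset.mem_compl.mp (Finset.orderEmbOfFin_mem Sᶜ hm i)
  have hsurj : ∀ x, x ∉ S → ∃ i, e i = x := by
    intro x hx
    have : x ∈ Set.range e := by
      rw [Finset.range_orderEmbOfFin]; simpa using hx
    exact this
  let ψ : Finset (Fin m) → Finset (Fin N) := fun T => S ∪ T.map e.toEmbedding
  have hmemψ : ∀ T i, e i ∈ ψ T ↔ i ∈ T := by
    intro T i
    simp only [ψ, Finset.mem_union, he i, false_or, Finset.mem_map]
    constructor
    · rintro ⟨j, hj, h⟩
      have : j = i := e.injective h
      rwa [← this]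
    · intro h; exact ⟨i, h, rfl⟩
  have hmono : ∀ T U, T ⊂ U → ψ T ⊂ ψ U := by
    intro T U h
    refine ⟨Finset.union_subset_union_right (Finset.map_subset_map.mpr h.1), fun h2 => h.2 ?_⟩
    intro i hi
    exact (hmemψ T i).mp (h2 ((hmemψ U i).mpr hi))
  have hinj : Function.Injective ψ := by
    intro T U h
    ext i
    rw [← hmemψ T i, h, hmemψ U i]
  have hcard : ∀ T, #(ψ T) = #S + #T := by
    intro T
    rw [Finset.card_union_of_disjoint, Finset.card_map]
    rw [Finset.disjoint_left]
    intro x hx hx'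
    obtain ⟨i, -, rfl⟩ := Finset.mem_map.mp hx'
    exact he i hx
  have hψ0 : ψ ∅ = S := by simp [ψ]
  let G : Finset (Finset (Fin m)) := univ.filter (fun T => T ≠ ∅ ∧ ψ T ∈ F)
  have hGmem : ∀ T, T ∈ G ↔ T ≠ ∅ ∧ ψ T ∈ F := by intro T; simp [G]
  have hlt : ∀ T ∈ G, S ⊂ ψ T := by
    intro T hT
    have h1 := ((hGmem T).mp hT).1
    have := hmono ∅ T (Finset.empty_ssubset.mpr (Finset.nonempty_iff_ne_empty.mpr h1))
    rwa [hψ0] at this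
  have himg : F.filter (fun B => S ⊂ B) = G.image ψ := by
    ext B
    simp only [Finset.mem_filter, Finset.mem_image]
    constructor
    · rintro ⟨hB, hSB⟩
      have hψ : ψ (univ.filter fun i => e i ∈ B) = B := by
        ext x
        simp only [ψ, Finset.mem_union, Finset.mem_map, Finset.mem_filter, Finset.mem_univ,
          true_and]
        constructor
        · rintro (h | ⟨i, hi, rfl⟩)
          · exact hSB.1 h
          · exact hi
        · intro hx
          by_cases hxS : x ∈ S
          · exact Or.inl hxS
          · obtain ⟨i, rfl⟩ := hsurj x hxS
            exact Or.inr ⟨i, hx, rfl⟩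
      refine ⟨_, (hGmem _).mpr ⟨?_, ?_⟩, hψ⟩
      · intro h
        rw [h, hψ0] at hψ
        exact hSB.ne hψ
      · rw [hψ]; exact hB
    · rintro ⟨T, hT, rfl⟩
      exact ⟨((hGmem T).mp hT).2, hlt T hT⟩
  rw [himg, Finset.sum_image (fun T _ U _ h => hinj h)]
  have hOne : OneBelow G := by
    intro C hC A hA B hB hAC hBC
    apply hinj
    exact diamond_ne F hF hS ((hGmem A).mp hA).2 ((hGmem B).mp hB).2 ((hGmem C).mp hC).2
      (hlt A hA) (hlt B hB) (hmono _ _ hAC) (hmono _ _ hBC)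
  have := lubell_le G hm2 (by simp [hGmem]) hOne
  simpa [hcard] using this

/-- Average number of members on a random chain above `S`. -/
noncomputable def lam (S : Finset (Fin N)) : ℝ :=
  ∑ B ∈ F.filter (fun B => S ⊆ B), 1 / ((#Sᶜ).choose (#B - #S) : ℝ)

lemma lam_mem (S : Finset (Fin N)) (hS : S ∈ F) :
    lam F S = 1 + ∑ B ∈ F.filter (fun B => S ⊂ B), 1 / ((#Sᶜ).choose (#B - #S) : ℝ) := by
  have : F.filter (fun B => S ⊆ B) = insert S (F.filter (fun B => S ⊂ B)) := by
    ext B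
    simp only [Finset.mem_filter, Finset.mem_insert]
    constructor
    · rintro ⟨h1, h2⟩
      by_cases h : B = S
      · exact Or.inl h
      · exact Or.inr ⟨h1, Finset.ssubset_iff_subset_ne.mpr ⟨h2, fun h' => h h'.symm⟩⟩
    · rintro (rfl | h)
      · exact ⟨hS, subset_rfl⟩
      · exact ⟨h.1, h.2.1⟩
  rw [lam, this, Finset.sum_insert (by simp)]
  simp

lemma lam_avg (S : Finset (Fin N)) (hS : S ∉ F) :
    (#Sᶜ : ℝ) * lam F S = ∑ x ∈ Sᶜ, lam F (insert x S) := by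
  unfold lam
  have h1 : ∀ x ∈ Sᶜ, ∑ B ∈ F.filter (fun B => insert x S ⊆ B),
        1 / ((#(insert x S)ᶜ).choose (#B - #(insert x S)) : ℝ) =
      ∑ B ∈ F.filter (fun B => S ⊆ B), if x ∈ B then
        1 / ((#Sᶜ - 1).choose (#B - #S - 1) : ℝ) else 0 := by
    intro x hx
    rw [← Finset.sum_filter, Finset.filter_filter]
    have hx' : x ∉ S := by simpa using hx
    refine Finset.sum_congr ?_ ?_
    · ext B
      simp only [Finset.mem_filter, Finset.insert_subset_iff]
      tauto
    · intro B _
      rw [Finset.card_insert_of_notMem hx', Finset.compl_insert, Finset.card_erase_of_mem hx,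
        Nat.sub_sub]
  rw [Finset.sum_congr rfl h1, Finset.sum_comm, Finset.mul_sum]
  refine Finset.sum_congr rfl fun B hB => ?_
  obtain ⟨hBF, hSB⟩ := Finset.mem_filter.mp hB
  have hne : S ≠ B := by rintro rfl; exact hS hBF
  have hlt := Finset.card_lt_card (Finset.ssubset_iff_subset_ne.mpr ⟨hSB, hne⟩)
  rw [← Finset.sum_filter, Finset.sum_const, nsmul_eq_mul]
  have h2 : Sᶜ.filter (fun x => x ∈ B) = B \ S := by
    ext x; simp [and_comm]
  rw [h2, Finset.card_sdiff_of_subset hSB]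
  have h3 : #B - #S ≤ #Sᶜ := by
    rw [← Finset.card_sdiff_of_subset hSB]
    apply Finset.card_le_card
    intro x; simp
  obtain ⟨b, hb⟩ : ∃ b, #B - #S = b + 1 := ⟨#B - #S - 1, by omega⟩
  obtain ⟨m, hm⟩ : ∃ m, #Sᶜ = m + 1 := ⟨#Sᶜ - 1, by omega⟩
  rw [hb, hm] at h3
  rw [hb, hm]
  simp only [Nat.add_sub_cancel]
  have h4 := Nat.add_one_mul_choose_eq m b
  have h5 : (0 : ℝ) < m.choose b := by exact_mod_cast Nat.choose_pos (by omega)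
  have h6 : (0 : ℝ) < (m + 1).choose (b + 1) := by exact_mod_cast Nat.choose_pos (by omega)
  rw [mul_one_div, mul_one_div, div_eq_div_iff h6.ne' h5.ne']
  have h7 : ((m + 1 : ℕ) : ℝ) * m.choose b = (m + 1).choose (b + 1) * ((b + 1 : ℕ) : ℝ) := by
    exact_mod_cast h4
  rw [h7, mul_comm]

lemma lam_le (hF : DkFree N 2 F) (hcard : ∀ A ∈ F, 2000 ≤ #Aᶜ) :
    ∀ k, ∀ S : Finset (Fin N), #Sᶜ = k → lam F S ≤ 25 / 11 := by
  intro k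
  induction k with
  | zero =>
    intro S hk
    have hS : S ∉ F := fun h => by have := hcard S h; omega
    have hSu : S = univ := by simpa using hk
    unfold lam
    rw [Finset.filter_false_of_mem]
    · norm_num
    · intro B hB h
      rw [hSu, Finset.univ_subset_iff] at h
      rw [hSu, ← h] at hS
      exact hS hB
  | succ k ih =>
    intro S hk
    by_cases hS : S ∈ F
    · rw [lam_mem F S hS]
      have := cone_bound F hF S hS _ rfl (hcard S hS)
      linarith
    · have h1 := lam_avg F S hS
      have h2 : ∑ x ∈ Sᶜ, lam F (insert x S) ≤ ∑ x ∈ Sᶜ, (25 / 11 : ℝ) := by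
        refine Finset.sum_le_sum fun x hx => ih _ ?_
        rw [Finset.compl_insert, Finset.card_erase_of_mem hx, hk]
        rfl
      rw [Finset.sum_const, nsmul_eq_mul, ← h1] at h2
      refine le_of_mul_le_mul_left h2 ?_
      rw [hk]
      positivity

lemma card_small (hF : DkFree N 2 F) (hcard : ∀ A ∈ F, 2000 ≤ #Aᶜ) :
    (#F : ℝ) ≤ 25 / 11 * N.choose (N / 2) := by
  have h1 := lam_le F hF hcard _ ∅ rfl
  have hpos : (0 : ℝ) < N.choose (N / 2) := by
    exact_mod_cast Nat.choose_pos (Nat.div_le_self N 2)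
  rw [← div_le_iff₀ hpos]
  refine le_trans ?_ h1
  unfold lam
  have h2 : (#F : ℝ) / N.choose (N / 2) = ∑ B ∈ F, 1 / (N.choose (N / 2) : ℝ) := by
    rw [Finset.sum_const, nsmul_eq_mul, mul_one_div]
  rw [h2]
  simp only [Finset.empty_subset, Finset.filter_true, Finset.compl_empty, Finset.card_univ,
    Fintype.card_fin, Finset.card_empty, Nat.sub_zero]
  refine Finset.sum_le_sum fun B _ => ?_
  have hB : #B ≤ N := by simpa using Finset.card_le_univ B
  apply one_div_le_one_div_of_le
  · exact_mod_cast Nat.choose_pos hB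
  · exact_mod_cast Nat.choose_le_middle _ _

end cone

lemma card_large (N K : ℕ) (hN : 1 ≤ N) :
    #((univ : Finset (Finset (Fin N))).filter fun A => #Aᶜ < K) ≤ K * N ^ K := by
  have h1 : (univ : Finset (Finset (Fin N))).filter (fun A => #Aᶜ < K) ⊆
      (Finset.range K).biUnion fun i => (Finset.powersetCard i univ).image compl := by
    intro A hA
    have hA : #Aᶜ < K := by simpa using hA
    rw [Finset.mem_biUnion]
    refine ⟨#Aᶜ, Finset.mem_range.mpr hA, Finset.mem_image.mpr ⟨Aᶜ, ?_, compl_compl A⟩⟩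
    simp [Finset.mem_powersetCard]
  refine (Finset.card_le_card h1).trans ?_
  refine (Finset.card_biUnion_le_card_mul _ _ (N ^ K) ?_).trans (by simp)
  intro i hi
  refine Finset.card_image_le.trans ?_
  rw [Finset.card_powersetCard, Finset.card_univ, Fintype.card_fin]
  exact (Nat.choose_le_pow N i).trans (Nat.pow_le_pow_right hN (Finset.mem_range.mp hi).le)

lemma two_pow_le (N : ℕ) : 2 ^ N ≤ (N + 1) * N.choose (N / 2) := by
  rw [← Nat.sum_range_choose]
  refine (Finset.sum_le_card_nsmul _ _ (N.choose (N / 2)) ?_).trans (by simp)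
  intro i _
  exact Nat.choose_le_middle _ _

lemma la_le (N : ℕ) (hN : 1 ≤ N) :
    (LaDiamond N : ℝ) ≤ 25 / 11 * N.choose (N / 2) + 2000 * (N : ℝ) ^ 2000 := by
  have hmem : LaDiamond N ∈ {c : ℕ | ∃ F : Finset (Finset (Fin N)), DkFree N 2 F ∧ F.card = c} := by
    apply Nat.sSup_mem
    · exact ⟨0, ∅, by simp [DkFree], rfl⟩
    · refine ⟨Fintype.card (Finset (Fin N)), ?_⟩
      rintro c ⟨F, -, rfl⟩
      exact Finset.card_le_univ F
  obtain ⟨F, hF, hc⟩ := hmem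
  rw [← hc]
  have h1 := Finset.card_filter_add_card_filter_not (s := F) (fun A => 2000 ≤ #Aᶜ)
  have h2 : (#(F.filter fun A => 2000 ≤ #Aᶜ) : ℝ) ≤ 25 / 11 * N.choose (N / 2) := by
    apply card_small
    · rintro ⟨A, C, B, hA, hC, hB, hrest⟩
      exact hF ⟨A, C, B, (Finset.mem_filter.mp hA).1, (Finset.mem_filter.mp hC).1,
        fun i => (Finset.mem_filter.mp (hB i)).1, hrest⟩
    · intro A hA
      exact (Finset.mem_filter.mp hA).2
  have h3 : #(F.filter fun A => ¬ 2000 ≤ #Aᶜ) ≤ 2000 * N ^ 2000 := by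
    refine le_trans (Finset.card_le_card ?_) (card_large N 2000 hN)
    intro A hA
    have := (Finset.mem_filter.mp hA).2
    simpa using this
  have h4 : (#(F.filter fun A => ¬ 2000 ≤ #Aᶜ) : ℝ) ≤ 2000 * (N : ℝ) ^ 2000 := by
    exact_mod_cast h3
  have h5 : (#F : ℝ) = #(F.filter fun A => 2000 ≤ #Aᶜ) + #(F.filter fun A => ¬ 2000 ≤ #Aᶜ) := by
    exact_mod_cast h1.symm
  rw [h5]
  exact add_le_add h2 h4

lemma ratio_upper (K : ℕ) (c x : ℝ) (N : ℕ) (hN : 1 ≤ N)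
    (hx : x ≤ c * N.choose (N / 2) + K * (N : ℝ) ^ K) :
    x / N.choose (N / 2) ≤ c + (2 * K) * ((N : ℝ) ^ (K + 1) / 2 ^ N) := by
  have hpos : (0 : ℝ) < N.choose (N / 2) := by
    exact_mod_cast Nat.choose_pos (Nat.div_le_self N 2)
  rw [div_le_iff₀ hpos, add_mul]
  refine hx.trans (add_le_add le_rfl ?_)
  have h1 : (2 : ℝ) ^ N ≤ (N + 1) * N.choose (N / 2) := by exact_mod_cast two_pow_le N
  have hN' : (1 : ℝ) ≤ N := by exact_mod_cast hN
  have h2 : (2 : ℝ) ^ N ≤ 2 * N * N.choose (N / 2) :=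
    h1.trans (mul_le_mul_of_nonneg_right (by linarith) hpos.le)
  have h3 : (0 : ℝ) < 2 ^ N := by positivity
  rw [← mul_div_assoc, div_mul_eq_mul_div, le_div_iff₀ h3]
  calc (K : ℝ) * (N : ℝ) ^ K * 2 ^ N ≤ K * (N : ℝ) ^ K * (2 * N * N.choose (N / 2)) := by
        gcongr
    _ = 2 * K * (N : ℝ) ^ (K + 1) * N.choose (N / 2) := by ring

lemma ratio_lower (N : ℕ) :
    2 - 2 * (1 / ((N : ℝ) + 1)) ≤ (LaDiamond N : ℝ) / N.choose (N / 2) := by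
  set h := N / 2 with hh
  have hpos : (0 : ℝ) < N.choose h := by
    exact_mod_cast Nat.choose_pos (Nat.div_le_self N 2)
  have h1 : N.choose h + N.choose (h + 1) ≤ LaDiamond N := by
    apply le_csSup
    · refine ⟨Fintype.card (Finset (Fin N)), ?_⟩
      rintro c ⟨F, -, rfl⟩
      exact Finset.card_le_univ F
    · refine ⟨Finset.powersetCard h univ ∪ Finset.powersetCard (h + 1) univ, ?_, ?_⟩
      · rintro ⟨A, C, B, hA, hC, hB, -, hne, -, hsub⟩
        have c1 := Finset.card_lt_card
          (Finset.ssubset_iff_subset_ne.mpr ⟨(hsub 0).1, (hne 0).1.symm⟩)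
        have c2 := Finset.card_lt_card
          (Finset.ssubset_iff_subset_ne.mpr ⟨(hsub 0).2, (hne 0).2⟩)
        simp only [Finset.mem_union, Finset.mem_powersetCard, Finset.subset_univ,
          true_and] at hA hC
        omega
      · rw [Finset.card_union_of_disjoint, Finset.card_powersetCard, Finset.card_powersetCard,
          Finset.card_univ, Fintype.card_fin]
        rw [Finset.disjoint_left]
        intro A hA hA'
        rw [Finset.mem_powersetCard] at hA hA'
        omega
  have h2 : (N.choose (h + 1) : ℝ) * (h + 1) = N.choose h * ((N - h : ℕ) : ℝ) := by
    exact_mod_cast Nat.choose_succ_right_eq N h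
  have h3 : (h : ℝ) ≤ ((N - h : ℕ) : ℝ) := by
    have : h ≤ N - h := by omega
    exact_mod_cast this
  have h4 : (N : ℝ) + 1 ≤ 2 * (h + 1) := by
    have : N + 1 ≤ 2 * (h + 1) := by omega
    exact_mod_cast this
  have h5 : (N.choose h : ℝ) * h ≤ N.choose (h + 1) * (h + 1) := by
    rw [h2]; gcongr
  have h6 : (N.choose h : ℝ) + N.choose (h + 1) ≤ LaDiamond N := by exact_mod_cast h1
  rw [le_div_iff₀ hpos]
  refine le_trans ?_ h6
  have hh1 : (0 : ℝ) < h + 1 := by positivity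
  have h7 : (N.choose h : ℝ) * (1 - 1 / (h + 1)) ≤ N.choose (h + 1) := by
    have : (1 : ℝ) - 1 / (h + 1) = h / (h + 1) := by field_simp; ring
    rw [this, ← mul_div_assoc, div_le_iff₀ hh1]
    exact h5
  have h8 : 1 / ((h : ℝ) + 1) ≤ 2 * (1 / ((N : ℝ) + 1)) := by
    rw [mul_one_div, div_le_div_iff₀ hh1 (by positivity)]
    linarith
  nlinarith

/-- If `La(n, D_2) / C(n, ⌊n/2⌋)` converges to a limit `L`, then
`2 ≤ L ≤ 25/11`. -/
theorem pi_diamond_bounds (L : ℝ)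
    (h : Tendsto (fun n : ℕ => (LaDiamond n : ℝ) / (n.choose (n / 2))) atTop (nhds L)) :
    2 ≤ L ∧ L ≤ 25 / 11 := by
  constructor
  · have h1 : Tendsto (fun n : ℕ => 2 - 2 * (1 / ((n : ℝ) + 1))) atTop (nhds (2 - 2 * 0)) :=
      tendsto_const_nhds.sub (tendsto_one_div_add_atTop_nhds_zero_nat.const_mul 2)
    have := le_of_tendsto_of_tendsto' h1 h ratio_lower
    linarith
  · have h1 := (tendsto_pow_const_div_const_pow_of_one_lt (2000 + 1)
      (r := (2 : ℝ)) (by norm_num)).const_mul (2 * ((2000 : ℕ) : ℝ))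
    have h2 := h1.const_add (25 / 11 : ℝ)
    have h3 := le_of_tendsto_of_tendsto h h2 (by
      filter_upwards [eventually_ge_atTop 1] with N hN
      exact ratio_upper 2000 (25 / 11) _ N hN (la_le N hN))
    linarith
end

section
/- Let k ≥ 2 and set m = ⌈log₂(k+2)⌉. Then for every n ≥ 1, the family B(n,m) of all subsets of [n] whose sizes lie among the m middle sizes is D_k-free. Consequently there is a D_k-free family of subsets of [n] of size Σ(n,m). -/
open Finset

/-- `Σ(n,m)`: the sum of the `m` largest binomial coefficients `C(n,i)`,
i.e. `Σ_{i=0}^{m-1} C(n, ⌊(n-m+1)/2⌋ + i)`. -/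
def middleBinomSum (n m : ℕ) : ℕ :=
  ∑ i ∈ Finset.range m, n.choose ((n - m + 1) / 2 + i)

/-- `B(n,m)` (lower variant): all subsets `A` of `[n]` with
`⌊(n-m+1)/2⌋ ≤ |A| ≤ ⌊(n+m-1)/2⌋`. -/
def Blow (n m : ℕ) : Finset (Finset (Fin n)) :=
  Finset.univ.filter (fun A => (n - m + 1) / 2 ≤ A.card ∧ A.card ≤ (n + m - 1) / 2)

/-- `B(n,m)` (upper variant): all subsets `A` of `[n]` with
`⌈(n-m+1)/2⌉ ≤ |A| ≤ ⌈(n+m-1)/2⌉`. -/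
def Bhigh (n m : ℕ) : Finset (Finset (Fin n)) :=
  Finset.univ.filter (fun A => (n - m + 2) / 2 ≤ A.card ∧ A.card ≤ (n + m) / 2)

theorem dkFree_of_width (k : ℕ) (hk : 2 ≤ k) (n : ℕ) (F : Finset (Finset (Fin n)))
    (hF : ∀ A ∈ F, ∀ C ∈ F, C.card < A.card + Nat.clog 2 (k + 2)) : DkFree n k F := by
  rintro ⟨A, C, B, hA, hC, hB, hinj, hne, hAC, hsub⟩
  have hm := hF A hA C hC
  have hpos : 0 < k := by omega
  have hsAC : A ⊆ C := (hsub ⟨0, hpos⟩).1.trans (hsub ⟨0, hpos⟩).2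
  have hlt : 2 ^ (C.card - A.card) < k + 2 := by
    refine (Nat.lt_clog_iff_pow_lt (by norm_num)).1 ?_
    have := Finset.card_le_card hsAC
    omega
  have hsubset : insert A (insert C (Finset.univ.image B)) ⊆ Finset.Icc A C := by
    intro X hX
    simp only [Finset.mem_insert, Finset.mem_image, Finset.mem_univ, true_and] at hX
    rw [Finset.mem_Icc]
    rcases hX with rfl | rfl | ⟨i, rfl⟩
    · exact ⟨le_rfl, hsAC⟩
    · exact ⟨hsAC, le_rfl⟩
    · exact hsub i
  have hcard := Finset.card_le_card hsubset
  rw [Finset.card_Icc_finset hsAC, Finset.card_insert_of_notMem, Finset.card_insert_of_notMem,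
    Finset.card_image_of_injective _ hinj, Finset.card_univ, Fintype.card_fin] at hcard
  · omega
  · simp only [Finset.mem_image, Finset.mem_univ, true_and, not_exists]
    exact fun i => (hne i).2
  · simp only [Finset.mem_insert, Finset.mem_image, Finset.mem_univ, true_and, not_or, not_exists]
    exact ⟨hAC, fun i => (hne i).1⟩

theorem card_levels (n a m : ℕ) :
    ((Finset.univ : Finset (Finset (Fin n))).filter
      (fun A => a ≤ A.card ∧ A.card < a + m)).card = ∑ i ∈ Finset.range m, n.choose (a + i) := by
  rw [Finset.card_eq_sum_card_fiberwise (f := fun A => A.card - a) (t := Finset.range m)]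
  · refine Finset.sum_congr rfl fun i hi => ?_
    have hi' := Finset.mem_range.1 hi
    have : ((Finset.univ : Finset (Finset (Fin n))).filter
      (fun A => a ≤ A.card ∧ A.card < a + m)).filter (fun A => A.card - a = i)
        = Finset.powersetCard (a + i) Finset.univ := by
      ext A
      simp only [Finset.mem_filter, Finset.mem_univ, true_and, Finset.mem_powersetCard,
        Finset.subset_univ]
      omega
    rw [this, Finset.card_powersetCard, Finset.card_univ, Fintype.card_fin]
  · intro A hA
    simp only [Finset.coe_filter, Finset.mem_univ, true_and, Set.mem_setOf_eq] at hA
    simp only [Finset.coe_range, Set.mem_Iio]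
    omega

/-- For `k ≥ 2` and `m = ⌈log₂(k+2)⌉`, the family `B(n,m)` of subsets of `[n]`
with sizes among the `m` middle sizes is `D_k`-free; consequently there is a
`D_k`-free family of subsets of `[n]` of size `Σ(n,m)`. -/
theorem middleLevels_dkFree (k : ℕ) (hk : 2 ≤ k) (n : ℕ) (hn : 1 ≤ n) :
    DkFree n k (Blow n (Nat.clog 2 (k + 2))) ∧
    DkFree n k (Bhigh n (Nat.clog 2 (k + 2))) ∧
    ∃ F : Finset (Finset (Fin n)),
      DkFree n k F ∧ F.card = middleBinomSum n (Nat.clog 2 (k + 2)) := by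
  have hm : 2 ≤ Nat.clog 2 (k + 2) :=
    (Nat.lt_clog_iff_pow_lt (by norm_num)).2 (by omega)
  have hle (A : Finset (Fin n)) : A.card ≤ n := by
    simpa using Finset.card_le_univ A
  refine ⟨dkFree_of_width k hk n _ ?_, dkFree_of_width k hk n _ ?_,
    Finset.univ.filter (fun A => (n - Nat.clog 2 (k + 2) + 1) / 2 ≤ A.card ∧
      A.card < (n - Nat.clog 2 (k + 2) + 1) / 2 + Nat.clog 2 (k + 2)),
    dkFree_of_width k hk n _ ?_, card_levels n _ _⟩
  all_goals
    intro A hA C hC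
    have h1 := hle A
    have h2 := hle C
    simp only [Blow, Bhigh, Finset.mem_filter, Finset.mem_univ, true_and] at hA hC
    omega
end

section
/- Let k ≥ 2, set m = ⌈log₂(k+2)⌉, and suppose 2^{m-1} − 1 ≤ k ≤ 2^m − C(m,⌊m/2⌋) − 1. Then for every n ≥ 1, every D_k-free family F of subsets of [n] has Lubell function h̄(F) ≤ m. -/
open Finset

/-- The Lubell function of a family `F` of subsets of `[n]`. -/
noncomputable def lubell (n : ℕ) (F : Finset (Finset (Fin n))) : ℝ :=
  ∑ A ∈ F, (1 : ℝ) / (n.choose A.card)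

lemma nat_bound (m d g : ℕ) (hm : 1 ≤ m) (hd : m ≤ d)
    (hg : g + m.choose (m / 2) ≤ 2 ^ m) :
    g + ∑ i ∈ range (d + 1), (d.choose ((m - 1) / 2) - d.choose i) ≤
      m * d.choose ((m - 1) / 2) := by
  obtain ⟨s, hs⟩ : ∃ s, s = (m - 1) / 2 := ⟨_, rfl⟩
  rw [← hs]
  have h1 : 2 ^ m ≤ 2 * ∑ i ∈ range s, m.choose i + (m - 2 * s) * m.choose s
      + m.choose (m / 2) := by
    have hcase : m = 2 * s + 1 ∨ m = 2 * s + 2 := by omega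
    rcases hcase with h | h
    · have h2 : m / 2 = s := by omega
      have h3 := Nat.sum_range_choose_halfway s
      rw [sum_range_succ, ← h] at h3
      have h4 : 2 ^ m = 2 * 4 ^ s := by
        rw [h, pow_succ, pow_mul]; norm_num; ring
      have h5 : m - 2 * s = 1 := by omega
      rw [h2, h4, h5, ← h3]; linarith
    · have h2 : m / 2 = s + 1 := by omega
      have h3 := Nat.sum_range_choose_halfway s
      have e : 2 * s + 1 + 1 = m := by omega
      have h4 : 2 ^ m = 4 * 4 ^ s := by
        rw [h, pow_add, pow_mul]; norm_num; ring
      have h5 : m - 2 * s = 2 := by omega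
      have h6 : ∑ i ∈ range s, m.choose i + m.choose s + m.choose (s + 1)
          = 2 * ∑ i ∈ range (s + 1), (2 * s + 1).choose i + (2 * s + 1).choose (s + 1) := by
        rw [← sum_range_succ, ← sum_range_succ, sum_range_succ', ← e]
        simp only [Nat.choose_succ_succ' (2 * s + 1), sum_add_distrib, Nat.choose_zero_right]
        have := sum_range_succ' (fun i => (2 * s + 1).choose i) (s + 1)
        rw [sum_range_succ] at this
        simp only [Nat.choose_zero_right] at this
        omega
      have h7 : (2 * s + 1).choose (s + 1) = (2 * s + 1).choose s := by
        apply Nat.choose_symm_of_eq_add; omega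
      have h8 : m.choose (s + 1) = 2 * (2 * s + 1).choose s := by
        rw [← e, Nat.choose_succ_succ, h7]; ring
      rw [h2, h4, h5, ← h3]
      rw [h3] at h6 ⊢
      omega
  have h2 : ∑ i ∈ range (d + 1), (d.choose s - d.choose i) ≤
      2 * ∑ i ∈ range s, (d.choose s - d.choose i) := by
    have hmono : ∀ i, s ≤ i → i ≤ d - s → d.choose s ≤ d.choose i := by
      intro i hi hi'
      have hmono2 : ∀ j, s ≤ j → j ≤ d / 2 → d.choose s ≤ d.choose j := by
        intro j hj
        induction j, hj using Nat.le_induction with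
        | base => intro; rfl
        | succ j hj ih =>
          intro hj2
          exact (ih (by omega)).trans (Nat.choose_le_succ_of_lt_half_left (by omega))
      by_cases hh : i ≤ d / 2
      · exact hmono2 i hi hh
      · rw [← Nat.choose_symm (show i ≤ d by omega)]
        exact hmono2 _ (by omega) (by omega)
    have e : d + 1 = s + (d + 1 - 2 * s) + s := by omega
    rw [e, sum_range_add, sum_range_add]
    have z : ∑ x ∈ range (d + 1 - 2 * s), (d.choose s - d.choose (s + x)) = 0 := by
      apply sum_eq_zero
      intro x hx
      rw [mem_range] at hx
      exact Nat.sub_eq_zero_of_le (hmono _ (by omega) (by omega))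
    have r : ∑ x ∈ range s, (d.choose s - d.choose (s + (d + 1 - 2 * s) + x))
        = ∑ i ∈ range s, (d.choose s - d.choose i) := by
      rw [← sum_range_reflect]
      apply sum_congr rfl
      intro x hx
      rw [mem_range] at hx
      congr 1
      apply Nat.choose_symm_of_eq_add
      omega
    rw [z, r]; omega
  have h3 : ∑ i ∈ range s, m.choose i + ∑ i ∈ range s, (d.choose s - d.choose i)
      ≤ s * d.choose s := by
    rw [← sum_add_distrib]
    calc _ ≤ ∑ i ∈ range s, d.choose s := by
          apply sum_le_sum
          intro i hi
          rw [mem_range] at hi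
          have a1 : m.choose i ≤ d.choose i := Nat.choose_le_choose i hd
          have a2 : d.choose i ≤ d.choose s := by
            have : ∀ j, i ≤ j → j ≤ d / 2 → d.choose i ≤ d.choose j := by
              intro j hj
              induction j, hj using Nat.le_induction with
              | base => intro; rfl
              | succ j hj ih =>
                intro hj2
                exact (ih (by omega)).trans (Nat.choose_le_succ_of_lt_half_left (by omega))
            exact this s hi.le (by omega)
          omega
      _ = _ := by simp
  have h4 : (m - 2 * s) * m.choose s ≤ (m - 2 * s) * d.choose s :=
    Nat.mul_le_mul_left _ (Nat.choose_le_choose s hd)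
  have h5 : m * d.choose s = 2 * (s * d.choose s) + (m - 2 * s) * d.choose s := by
    conv_lhs => rw [show m = 2 * s + (m - 2 * s) by omega]
    ring
  omega

lemma key {V : Type*} [DecidableEq V] (m : ℕ) (hm : 1 ≤ m) (D : Finset V)
    (G : Finset (Finset V)) (hG : G ⊆ D.powerset)
    (h : D.card < m ∨ G.card + m.choose (m / 2) ≤ 2 ^ m) :
    ∑ Y ∈ G, (1 : ℝ) / (D.card.choose Y.card) ≤ m := by
  have hps : ∀ i ∈ range (D.card + 1), (0 : ℝ) < D.card.choose i := by
    intro i hi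
    rw [mem_range] at hi
    exact_mod_cast Nat.choose_pos (by omega)
  by_cases hd : D.card < m
  · calc _ ≤ ∑ Y ∈ D.powerset, (1 : ℝ) / (D.card.choose Y.card) :=
          sum_le_sum_of_subset_of_nonneg hG (fun _ _ _ => by positivity)
      _ = ∑ i ∈ range (D.card + 1), (D.card.choose i) • ((1 : ℝ) / (D.card.choose i)) :=
          sum_powerset_apply_card (fun i => (1 : ℝ) / (D.card.choose i))
      _ = ∑ i ∈ range (D.card + 1), (1 : ℝ) := by
          apply sum_congr rfl
          intro i hi
          have := hps i hi
          rw [nsmul_eq_mul]; field_simp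
      _ = ((D.card + 1 : ℕ) : ℝ) := by simp
      _ ≤ m := by exact_mod_cast hd
  · have hg : G.card + m.choose (m / 2) ≤ 2 ^ m := h.resolve_left hd
    have hb := nat_bound m D.card G.card hm (by omega) hg
    set c := D.card.choose ((m - 1) / 2) with hc
    have hcpos : (0 : ℝ) < c := by
      exact_mod_cast Nat.choose_pos (by omega)
    have hmain : ∑ Y ∈ G, (1 : ℝ) / (D.card.choose Y.card) ≤
        ∑ Y ∈ G, (1 : ℝ) / c + ∑ Y ∈ D.powerset,
          (((c - D.card.choose Y.card : ℕ) : ℝ) / (c * D.card.choose Y.card)) := by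
      calc _ ≤ ∑ Y ∈ G, ((1 : ℝ) / c +
              (((c - D.card.choose Y.card : ℕ) : ℝ) / (c * D.card.choose Y.card))) := by
            apply sum_le_sum
            intro Y hY
            have hY' := card_le_card (mem_powerset.1 (hG hY))
            have hp := hps Y.card (by rw [mem_range]; omega)
            have : (c : ℝ) ≤ (c - D.card.choose Y.card : ℕ) + D.card.choose Y.card := by
              exact_mod_cast (by omega)
            rw [div_add_div _ _ hcpos.ne' (by positivity), div_le_div_iff₀ hp (by positivity)]
            have := mul_le_mul_of_nonneg_left this
              (show (0 : ℝ) ≤ c * D.card.choose Y.card by positivity)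
            nlinarith
        _ ≤ _ := by
            rw [sum_add_distrib]
            gcongr
    refine hmain.trans ?_
    rw [sum_powerset_apply_card
      (fun i => (((c - D.card.choose i : ℕ) : ℝ) / (c * D.card.choose i)))]
    have e : ∑ i ∈ range (D.card + 1), (D.card.choose i) •
        (((c - D.card.choose i : ℕ) : ℝ) / (c * D.card.choose i)) =
        (∑ i ∈ range (D.card + 1), ((c - D.card.choose i : ℕ) : ℝ)) / c := by
      rw [sum_div]
      apply sum_congr rfl
      intro i hi
      have := hps i hi
      rw [nsmul_eq_mul]; field_simp
    rw [e, sum_const, nsmul_eq_mul, mul_one_div, ← add_div, div_le_iff₀ hcpos]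
    exact_mod_cast hb

section alpha
variable {V : Type*} [DecidableEq V]

/-- Probability that a random maximal chain from the empty set to `X` meets `F` at most in `X`. -/
noncomputable def al (F : Finset (Finset V)) (X : Finset V) : ℝ :=
  1 - ∑ A ∈ ({A ∈ F | A ⊂ X}).attach, al F A.1 / (X.card.choose A.1.card)
termination_by X.card
decreasing_by exact card_lt_card (mem_filter.1 A.2).2

lemma al_eq (F : Finset (Finset V)) (X : Finset V) :
    al F X = 1 - ∑ A ∈ F with A ⊂ X, al F A / (X.card.choose A.card) := by
  rw [al, sum_attach _ (fun A => al F A / (X.card.choose A.card))]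

lemma al_sub (F : Finset (Finset V)) (X : Finset V) :
    1 - ∑ A ∈ F with A ⊆ X, al F A / (X.card.choose A.card) =
      if X ∈ F then 0 else al F X := by
  split_ifs with h
  · have : ({A ∈ F | A ⊆ X}) = insert X ({A ∈ F | A ⊂ X}) := by
      ext A
      simp only [mem_filter, mem_insert, subset_iff_ssubset_or_eq]
      constructor
      · tauto
      · rintro (rfl | h') <;> tauto
    rw [this, sum_insert (by simp), al_eq F X]
    simp
  · rw [al_eq]
    congr 2
    ext A
    simp only [mem_filter, subset_iff_ssubset_or_eq]
    constructor
    · rintro ⟨h1, h2 | rfl⟩ <;> tauto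
    · tauto

lemma al_nonneg (F : Finset (Finset V)) (X : Finset V) : 0 ≤ al F X := by
  induction X using Finset.strongInduction with
  | H X ih =>
  rcases X.eq_empty_or_nonempty with rfl | hX
  · rw [al_eq]; simp
  have hpos : (0 : ℝ) < X.card := by exact_mod_cast hX.card_pos
  have h1 : ∑ x ∈ X, (if X.erase x ∈ F then 0 else al F (X.erase x)) = X.card * al F X := by
    simp_rw [← al_sub]
    rw [sum_sub_distrib, al_eq, mul_sub, mul_sum]
    congr 1
    · simp
    simp_rw [sum_filter]
    rw [sum_comm]
    apply sum_congr rfl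
    intro A hA
    have hc : ∀ x ∈ X, (X.erase x).card = X.card - 1 := fun x hx => card_erase_of_mem hx
    by_cases hAX : A ⊂ X
    · have hlt := card_lt_card hAX
      have : ∑ x ∈ X, (if A ⊆ X.erase x then al F A / ((X.erase x).card.choose A.card) else 0)
          = ∑ x ∈ X \ A, al F A / ((X.card - 1).choose A.card) := by
        rw [← sum_filter]
        apply sum_congr
        · ext x
          simp only [mem_filter, mem_sdiff, subset_erase]
          have := hAX.subset
          tauto
        · intro x hx
          rw [hc x (mem_sdiff.1 hx).1]
      rw [this, if_pos hAX, sum_const, card_sdiff_of_subset hAX.subset, nsmul_eq_mul,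
        Nat.cast_sub hlt.le]
      obtain ⟨y, hy⟩ : ∃ y, X.card = y + 1 := ⟨X.card - 1, by omega⟩
      have e := Nat.choose_mul_succ_eq y A.card
      rw [← hy] at e
      have p1 : (0 : ℝ) < y.choose A.card := by exact_mod_cast Nat.choose_pos (by omega)
      have p2 : (0 : ℝ) < X.card.choose A.card := by exact_mod_cast Nat.choose_pos (by omega)
      have e' : (y.choose A.card : ℝ) * X.card = X.card.choose A.card * (X.card - A.card) := by
        rw [← Nat.cast_sub hlt.le]; exact_mod_cast e
      have : X.card - 1 = y := by omega
      rw [this]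
      field_simp
      linear_combination -(al F A) * e'
    · rw [if_neg hAX]
      apply sum_eq_zero
      intro x hx
      rw [if_neg]
      intro hs
      exact hAX (lt_of_le_of_lt hs (erase_ssubset hx))
  have h2 : 0 ≤ X.card * al F X := by
    rw [← h1]
    apply sum_nonneg
    intro x hx
    split_ifs
    · exact le_rfl
    · exact ih _ (erase_ssubset hx)
  exact nonneg_of_mul_nonneg_right h2 hpos

lemma al_full (F : Finset (Finset V)) (X : Finset V) (hX : X ∈ F) :
    ∑ A ∈ F with A ⊆ X, al F A / (X.card.choose A.card) = 1 := by
  have := al_sub F X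
  rw [if_pos hX] at this
  linarith

lemma al_le (F : Finset (Finset V)) (X : Finset V) :
    ∑ A ∈ F with A ⊆ X, al F A / (X.card.choose A.card) ≤ 1 := by
  have := al_sub F X
  have h2 := al_nonneg F X
  split_ifs at this <;> linarith

end alpha

/-- Dual of `al`. -/
noncomputable def be {n : ℕ} (F : Finset (Finset (Fin n))) (X : Finset (Fin n)) : ℝ :=
  al (F.image compl) Xᶜ

lemma be_sum {n : ℕ} (F : Finset (Finset (Fin n))) (X : Finset (Fin n)) :
    ∑ A ∈ F.image compl with A ⊆ Xᶜ, al (F.image compl) A / (Xᶜ.card.choose A.card) =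
    ∑ B ∈ F with X ⊆ B, be F B / ((n - X.card).choose (n - B.card)) := by
  rw [sum_filter, sum_image (fun a _ b _ h => compl_injective h), sum_filter]
  apply sum_congr rfl
  intro B hB
  simp only [compl_subset_compl, card_compl, Fintype.card_fin, be]

lemma be_nonneg {n : ℕ} (F : Finset (Finset (Fin n))) (X : Finset (Fin n)) : 0 ≤ be F X :=
  al_nonneg _ _

lemma be_full {n : ℕ} (F : Finset (Finset (Fin n))) (X : Finset (Fin n)) (hX : X ∈ F) :
    ∑ B ∈ F with X ⊆ B, be F B / ((n - X.card).choose (n - B.card)) = 1 := by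
  rw [← be_sum]
  exact al_full _ _ (mem_image_of_mem _ hX)

lemma be_le {n : ℕ} (F : Finset (Finset (Fin n))) :
    ∑ B ∈ F, be F B / (n.choose B.card) ≤ 1 := by
  have := al_le (F.image compl) (∅ : Finset (Fin n))ᶜ
  rw [be_sum] at this
  simp only [empty_subset, filter_true, card_empty, Nat.sub_zero] at this
  refine le_trans (le_of_eq ?_) this
  apply sum_congr rfl
  intro B _
  rw [Nat.choose_symm (by simpa using card_le_univ B)]

lemma multinom (n a x b : ℕ) (h1 : a ≤ x) (h2 : x ≤ b) (h3 : b ≤ n) :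
    n.choose x * x.choose a * (n - x).choose (n - b) =
      n.choose b * b.choose a * (b - a).choose (x - a) := by
  have e1 : (n - x).choose (n - b) = (n - x).choose (b - x) :=
    Nat.choose_symm_of_eq_add (by omega)
  have e2 := Nat.choose_mul (n := n) h2
  have e3 := Nat.choose_mul (n := b) h1
  rw [e1, mul_right_comm, ← e2, mul_assoc, e3, mul_assoc]

lemma interval_bound (k m n : ℕ) (hm : 1 ≤ m) (hk2 : k + 1 + m.choose (m / 2) ≤ 2 ^ m)
    (F : Finset (Finset (Fin n))) (hF : DkFree n k F)
    (A B : Finset (Fin n)) (hA : A ∈ F) (hB : B ∈ F) (hAB : A ⊆ B) :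
    ∑ X ∈ F with A ⊆ X ∧ X ⊆ B, (1 : ℝ) / ((B.card - A.card).choose (X.card - A.card)) ≤ m := by
  set S := {X ∈ F | A ⊆ X ∧ X ⊆ B} with hS
  have hinj : Set.InjOn (fun X => X \ A) (S : Set (Finset (Fin n))) := by
    intro X hX Y hY hXY
    simp only [hS, coe_filter, Set.mem_setOf_eq] at hX hY
    simp only at hXY
    rw [← sdiff_union_of_subset hX.2.1, hXY, sdiff_union_of_subset hY.2.1]
  have hk := key m hm (B \ A) (S.image (fun X => X \ A)) (by
    intro Y hY
    rw [mem_image] at hY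
    obtain ⟨X, hX, rfl⟩ := hY
    rw [hS, mem_filter] at hX
    rw [mem_powerset]
    exact sdiff_subset_sdiff hX.2.2 le_rfl) (by
    rw [card_image_of_injOn hinj]
    by_contra hcon
    push Not at hcon
    obtain ⟨c1, c2⟩ := hcon
    have hne : A ≠ B := by
      rintro rfl
      simp at c1
      omega
    apply hF
    have hcard : k ≤ ((S.erase A).erase B).card := by
      have := pred_card_le_card_erase (s := S) (a := A)
      have := pred_card_le_card_erase (s := S.erase A) (a := B)
      omega
    obtain ⟨T, hT, hTc⟩ := exists_subset_card_eq hcard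
    let e := T.equivFinOfCardEq hTc
    have hmem : ∀ i, (e.symm i : Finset (Fin n)) ≠ B ∧ (e.symm i : Finset (Fin n)) ≠ A ∧
        (e.symm i : Finset (Fin n)) ∈ F ∧ A ⊆ (e.symm i : Finset (Fin n)) ∧
        (e.symm i : Finset (Fin n)) ⊆ B := by
      intro i
      have := hT (e.symm i).2
      simpa [hS, mem_erase, mem_filter] using this
    exact ⟨A, B, fun i => (e.symm i : Finset (Fin n)), hA, hB, fun i => (hmem i).2.2.1,
      Subtype.val_injective.comp e.symm.injective, fun i => ⟨(hmem i).2.1, (hmem i).1⟩, hne,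
      fun i => (hmem i).2.2.2⟩)
  rw [sum_image hinj, card_sdiff_of_subset hAB] at hk
  refine le_trans (le_of_eq ?_) hk
  apply sum_congr rfl
  intro X hX
  rw [hS, mem_filter] at hX
  rw [card_sdiff_of_subset hX.2.1]

/-- For `k ≥ 2`, `m = ⌈log₂(k+2)⌉`, and `2^{m-1} - 1 ≤ k ≤ 2^m - C(m,⌊m/2⌋) - 1`,
every `D_k`-free family of subsets of `[n]` has Lubell function at most `m`. -/
theorem lubell_le_of_dkFree_case1 (k : ℕ) (hk : 2 ≤ k) (m : ℕ)
    (hm : m = Nat.clog 2 (k + 2))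
    (hk1 : 2 ^ (m - 1) - 1 ≤ k) (hk2 : k ≤ 2 ^ m - m.choose (m / 2) - 1)
    (n : ℕ) (hn : 1 ≤ n)
    (F : Finset (Finset (Fin n))) (hF : DkFree n k F) :
    lubell n F ≤ m := by
  have hk3 : k + 1 + m.choose (m / 2) ≤ 2 ^ m := by omega
  have hm1 : 1 ≤ m := by
    rcases Nat.eq_zero_or_pos m with h | h
    · rw [h] at hk3; simp at hk3
    · exact h
  clear hm hk1 hk2
  have hcn : ∀ X : Finset (Fin n), X.card ≤ n := fun X => by simpa using card_le_univ X
  have step1 : lubell n F = ∑ A ∈ F, ∑ B ∈ F, if A ⊆ B then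
      al F A * be F B / (n.choose B.card * B.card.choose A.card) *
        ∑ X ∈ F with A ⊆ X ∧ X ⊆ B, (1 : ℝ) / ((B.card - A.card).choose (X.card - A.card))
      else 0 := by
    have : ∀ X ∈ F, (1 : ℝ) / (n.choose X.card) = ∑ A ∈ F, ∑ B ∈ F,
        if A ⊆ X ∧ X ⊆ B then al F A * be F B / (n.choose B.card * B.card.choose A.card) *
          ((1 : ℝ) / ((B.card - A.card).choose (X.card - A.card))) else 0 := by
      intro X hX
      have : (1 : ℝ) / (n.choose X.card) = 1 / (n.choose X.card) *
          ((∑ A ∈ F with A ⊆ X, al F A / (X.card.choose A.card)) *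
          ∑ B ∈ F with X ⊆ B, be F B / ((n - X.card).choose (n - B.card))) := by
        rw [al_full F X hX, be_full F X hX]; ring
      rw [this, sum_filter, sum_filter, sum_mul_sum, mul_sum]
      apply sum_congr rfl
      intro A _
      rw [mul_sum]
      apply sum_congr rfl
      intro B _
      by_cases h1 : A ⊆ X
      · by_cases h2 : X ⊆ B
        · rw [if_pos h1, if_pos h2, if_pos ⟨h1, h2⟩]
          have e := multinom n A.card X.card B.card (card_le_card h1) (card_le_card h2) (hcn B)
          have e' : (n.choose X.card : ℝ) * X.card.choose A.card *
            (n - X.card).choose (n - B.card) = n.choose B.card * B.card.choose A.card *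
            (B.card - A.card).choose (X.card - A.card) := by exact_mod_cast e
          rw [div_mul_div_comm, div_mul_div_comm, div_mul_div_comm, ← e']
          ring
        · simp [h2]
      · simp [h1]
    unfold lubell
    rw [sum_congr rfl this, sum_comm]
    apply sum_congr rfl
    intro A _
    rw [sum_comm]
    apply sum_congr rfl
    intro B _
    split_ifs with h
    · rw [mul_sum, sum_filter]
    · apply sum_eq_zero
      intro X _
      rw [if_neg]
      rintro ⟨h1, h2⟩
      exact h (h1.trans h2)
  rw [step1]
  calc _ ≤ ∑ A ∈ F, ∑ B ∈ F, if A ⊆ B then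
      al F A * be F B / (n.choose B.card * B.card.choose A.card) * (m : ℝ) else 0 := by
        apply sum_le_sum
        intro A hA
        apply sum_le_sum
        intro B hB
        split_ifs with h
        · apply mul_le_mul_of_nonneg_left
            (interval_bound k m n hm1 hk3 F hF A B hA hB h)
          have := al_nonneg F A
          have := be_nonneg F B
          positivity
        · exact le_rfl
    _ = (∑ B ∈ F, be F B / (n.choose B.card)) * m := by
        rw [sum_comm, sum_mul]
        apply sum_congr rfl
        intro B hB
        rw [← mul_one (be F B / _), ← al_full F B hB, sum_filter, mul_sum, sum_mul]
        apply sum_congr rfl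
        intro A _
        split_ifs with h
        · rw [div_mul_div_comm, mul_comm (al F A)]
        · simp
    _ ≤ 1 * m := by
        gcongr
        exact be_le F
    _ = m := one_mul _
end

section
/- Let k ≥ 2, set m = ⌈log₂(k+2)⌉, and suppose 2^{m-1} − 1 ≤ k ≤ 2^m − C(m,⌊m/2⌋) − 1. Then for every n ≥ 1, every D_k-free family F of subsets of [n] satisfies |F| ≤ Σ(n,m). -/
open Finset

lemma aux_choose_le {r i j : ℕ} (h1 : i ≤ j) (h2 : i + j ≤ r) : r.choose i ≤ r.choose j := by
  have key : ∀ j, i ≤ j → j ≤ r / 2 → r.choose i ≤ r.choose j := by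
    intro j hij
    induction j, hij using Nat.le_induction with
    | base => intro _; exact le_rfl
    | succ j hj ih =>
      intro h
      exact (ih (by omega)).trans (Nat.choose_le_succ_of_lt_half_left (by omega))
  by_cases h : j ≤ r / 2
  · exact key j h1 h
  · rw [← Nat.choose_symm (show j ≤ r by omega)]
    exact key _ (by omega) (by omega)

lemma aux_lp (I T : Finset ℕ) (hT : T ⊆ I) (x w : ℕ → ℚ) (c : ℚ)
    (h0 : ∀ i ∈ I, 0 ≤ x i) (h1 : ∀ i ∈ I, x i ≤ 1)
    (hin : ∀ i ∈ T, w i ≤ c) (hout : ∀ i ∈ I, i ∉ T → c ≤ w i) :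
    c * (∑ i ∈ I, x i - T.card) ≤ ∑ i ∈ I, w i * x i - ∑ i ∈ T, w i := by
  have e : ∑ i ∈ I, (w i - c) * (x i - if i ∈ T then 1 else 0) =
      (∑ i ∈ I, w i * x i - ∑ i ∈ T, w i) - c * (∑ i ∈ I, x i - T.card) := by
    have e1 : ∑ i ∈ T, w i = ∑ i ∈ I, if i ∈ T then w i else 0 := by
      rw [← Finset.sum_filter, Finset.filter_mem_eq_inter, Finset.inter_eq_right.2 hT]
    have e2 : (T.card : ℚ) = ∑ i ∈ I, if i ∈ T then (1 : ℚ) else 0 := by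
      rw [← Finset.sum_filter, Finset.filter_mem_eq_inter, Finset.inter_eq_right.2 hT]
      simp
    rw [e1, e2, ← Finset.sum_sub_distrib, ← Finset.sum_sub_distrib, Finset.mul_sum,
      ← Finset.sum_sub_distrib]
    apply Finset.sum_congr rfl
    intro i _
    split_ifs <;> ring
  have : 0 ≤ ∑ i ∈ I, (w i - c) * (x i - if i ∈ T then 1 else 0) := by
    apply Finset.sum_nonneg
    intro i hi
    split_ifs with h
    · exact mul_nonneg_of_nonpos_of_nonpos (by linarith [hin i h]) (by linarith [h1 i hi])
    · exact mul_nonneg (by linarith [hout i hi h]) (by linarith [h0 i hi])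
  linarith

/-- The Lubell function of `F` in the interval `[X, Y]`. -/
def lub {n : ℕ} (F : Finset (Finset (Fin n))) (X Y : Finset (Fin n)) : ℚ :=
  ∑ B ∈ F with X ⊆ B ∧ B ⊆ Y, (1 : ℚ) / ((#Y - #X).choose (#B - #X))

/-- Fraction of level `s` of the interval `[X, Y]` occupied by `F`. -/
def frac {n : ℕ} (F : Finset (Finset (Fin n))) (X Y : Finset (Fin n)) (s : ℕ) : ℚ :=
  (#{B ∈ F | (X ⊆ B ∧ B ⊆ Y) ∧ #B - #X = s} : ℚ) / ((#Y - #X).choose s)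

lemma frac_nonneg {n : ℕ} (F : Finset (Finset (Fin n))) (X Y : Finset (Fin n)) (s : ℕ) :
    0 ≤ frac F X Y s := by unfold frac; positivity

lemma frac_le_one {n : ℕ} (F : Finset (Finset (Fin n))) (X Y : Finset (Fin n)) (hXY : X ⊆ Y)
    (s : ℕ) : frac F X Y s ≤ 1 := by
  unfold frac
  apply div_le_one_of_le₀ _ (by positivity)
  norm_cast
  rw [← Finset.card_sdiff_of_subset hXY, ← Finset.card_powersetCard]
  apply Finset.card_le_card_of_injOn (fun B => B \ X)
  · intro B hB
    simp only [Finset.coe_filter, Set.mem_ofPred_eq] at hB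
    simp only [Finset.mem_coe, Finset.mem_powersetCard]
    exact ⟨Finset.sdiff_subset_sdiff hB.2.1.2 le_rfl,
      by rw [Finset.card_sdiff_of_subset hB.2.1.1, hB.2.2]⟩
  · intro B hB C hC h
    simp only [Finset.coe_filter, Set.mem_ofPred_eq] at hB hC
    simp only at h
    rw [← Finset.sdiff_union_of_subset hB.2.1.1, ← Finset.sdiff_union_of_subset hC.2.1.1, h]

lemma frac_maps {n : ℕ} (F : Finset (Finset (Fin n))) (X Y : Finset (Fin n)) :
    ∀ B ∈ ({B ∈ F | X ⊆ B ∧ B ⊆ Y} : Finset _), #B - #X ∈ range (#Y - #X + 1) := by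
  intro B hB
  simp only [Finset.mem_filter] at hB
  have := Finset.card_le_card hB.2.2
  rw [Finset.mem_range]; omega

lemma lub_eq {n : ℕ} (F : Finset (Finset (Fin n))) (X Y : Finset (Fin n)) :
    lub F X Y = ∑ s ∈ range (#Y - #X + 1), frac F X Y s := by
  unfold lub
  rw [← Finset.sum_fiberwise_of_maps_to (frac_maps F X Y)]
  apply Finset.sum_congr rfl
  intro s _
  unfold frac
  rw [Finset.filter_filter, Finset.sum_congr rfl (g := fun _ => (1 : ℚ) / ((#Y - #X).choose s))]
  · rw [Finset.sum_const, nsmul_eq_mul, mul_one_div]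
  · intro B hB
    rw [(Finset.mem_filter.1 hB).2.2]

lemma card_eq_frac {n : ℕ} (F : Finset (Finset (Fin n))) (X Y : Finset (Fin n)) :
    (#{B ∈ F | X ⊆ B ∧ B ⊆ Y} : ℚ) =
      ∑ s ∈ range (#Y - #X + 1), ((#Y - #X).choose s : ℚ) * frac F X Y s := by
  rw [Finset.card_eq_sum_card_fiberwise (frac_maps F X Y)]
  push_cast
  apply Finset.sum_congr rfl
  intro s hs
  unfold frac
  have : ((#Y - #X).choose s : ℚ) ≠ 0 := by
    have := Nat.choose_pos (show s ≤ #Y - #X by rw [Finset.mem_range] at hs; omega)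
    positivity
  rw [Finset.filter_filter]
  field_simp

lemma two_pow_split (m : ℕ) :
    2 ^ m = ∑ i ∈ range (m / 2), m.choose i + m.choose (m / 2)
      + ∑ j ∈ range (m - m / 2), m.choose j := by
  rw [← Nat.sum_range_choose, ← Finset.sum_range_succ,
    ← Finset.sum_range_add_sum_Ico _ (show m / 2 + 1 ≤ m + 1 by omega)]
  congr 1
  rw [Finset.sum_Ico_eq_sum_range, ← Finset.sum_range_reflect,
    show m + 1 - (m / 2 + 1) = m - m / 2 by omega]
  apply Finset.sum_congr rfl
  intro j hj
  rw [Finset.mem_range] at hj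
  rw [← Nat.choose_symm (show j ≤ m by omega)]
  congr 1
  omega

lemma lub_le_of_card {n m : ℕ} (hm : 1 ≤ m) (F : Finset (Finset (Fin n)))
    (X Y : Finset (Fin n)) (hXY : X ⊆ Y)
    (hc : #{B ∈ F | X ⊆ B ∧ B ⊆ Y} + m.choose (m / 2) ≤ 2 ^ m) : lub F X Y ≤ m := by
  have hcard := card_eq_frac F X Y
  rw [lub_eq]
  set r := #Y - #X with hr
  by_cases hrm : r < m
  · calc ∑ s ∈ range (r + 1), frac F X Y s ≤ ∑ s ∈ range (r + 1), (1 : ℚ) :=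
        Finset.sum_le_sum fun s _ => frac_le_one F X Y hXY s
      _ = ((r + 1 : ℕ) : ℚ) := by simp
      _ ≤ m := by exact_mod_cast hrm
  push Not at hrm
  set a := m / 2 with ha
  have hinj : Set.InjOn (fun j => r - j) (range (m - a) : Finset ℕ) := by
    intro i hi j hj h
    simp only [Finset.coe_range, Set.mem_Iio] at hi hj h
    omega
  have hdisj : Disjoint (range a) ((range (m - a)).image (fun j => r - j)) := by
    rw [Finset.disjoint_left]
    intro i hi h
    simp only [Finset.mem_image, Finset.mem_range] at hi h
    omega
  set T := range a ∪ (range (m - a)).image (fun j => r - j) with hTdef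
  have hTcard : #T = m := by
    rw [hTdef, Finset.card_union_of_disjoint hdisj, Finset.card_image_of_injOn hinj]
    simp; omega
  have hTsum : ∑ i ∈ T, (r.choose i : ℚ) =
      ((∑ i ∈ range a, r.choose i + ∑ j ∈ range (m - a), r.choose j : ℕ) : ℚ) := by
    rw [hTdef, Finset.sum_union hdisj, Finset.sum_image hinj]
    push_cast
    congr 1
    apply Finset.sum_congr rfl
    intro j hj
    rw [Finset.mem_range] at hj
    rw [Nat.choose_symm (by omega)]
  have hlp := aux_lp (range (r + 1)) T (by
      intro i hi
      simp only [hTdef, Finset.mem_union, Finset.mem_image, Finset.mem_range] at hi ⊢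
      omega) (frac F X Y) (fun i => (r.choose i : ℚ)) (r.choose (m - a - 1) : ℚ)
    (fun i _ => frac_nonneg F X Y i) (fun i _ => frac_le_one F X Y hXY i)
    (by
      intro i hi
      simp only [hTdef, Finset.mem_union, Finset.mem_image, Finset.mem_range] at hi
      simp only [Nat.cast_le]
      rcases hi with hi | ⟨j, hj, rfl⟩
      · exact aux_choose_le (by omega) (by omega)
      · rw [Nat.choose_symm (by omega)]
        exact aux_choose_le (by omega) (by omega))
    (by
      intro i hi hiT
      simp only [hTdef, Finset.mem_union, Finset.mem_image, Finset.mem_range, not_or,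
        not_exists, not_and] at hi hiT
      simp only [Nat.cast_le]
      have := hiT.2 (r - i)
      exact aux_choose_le (by omega) (by omega))
  rw [hTsum, ← hcard, hTcard] at hlp
  have hle : (#{B ∈ F | X ⊆ B ∧ B ⊆ Y} : ℚ) ≤
      ((∑ i ∈ range a, r.choose i + ∑ j ∈ range (m - a), r.choose j : ℕ) : ℚ) := by
    have h2 := two_pow_split m
    rw [← ha] at h2
    have h3 : ∑ i ∈ range a, m.choose i ≤ ∑ i ∈ range a, r.choose i :=
      Finset.sum_le_sum fun i _ => Nat.choose_le_choose i hrm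
    have h4 : ∑ i ∈ range (m - a), m.choose i ≤ ∑ i ∈ range (m - a), r.choose i :=
      Finset.sum_le_sum fun i _ => Nat.choose_le_choose i hrm
    rw [Nat.cast_le]
    omega
  have hpos : (0 : ℚ) < r.choose (m - a - 1) := by
    have := Nat.choose_pos (show m - a - 1 ≤ r by omega)
    positivity
  by_contra hcon
  push Not at hcon
  have := mul_pos hpos (sub_pos.2 hcon)
  linarith

lemma card_le_of_lub {n m : ℕ} (hm : 1 ≤ m) (F : Finset (Finset (Fin n)))
    (h : lub F ∅ univ ≤ m) : #F ≤ middleBinomSum n m := by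
  have hcard := card_eq_frac F ∅ univ
  rw [lub_eq] at h
  simp only [Finset.card_univ, Fintype.card_fin, Finset.card_empty, Nat.sub_zero,
    Finset.empty_subset, Finset.subset_univ, and_self, Finset.filter_true] at h hcard
  unfold middleBinomSum
  by_cases hnm : n < m
  · have e : (n - m + 1) / 2 = 0 := by omega
    simp only [e, zero_add]
    calc #F ≤ 2 ^ n := by
          have := Finset.card_le_univ F
          simpa using this
      _ = ∑ i ∈ range (n + 1), n.choose i := (Nat.sum_range_choose n).symm
      _ ≤ _ := Finset.sum_le_sum_of_subset (Finset.range_mono hnm)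
  push Not at hnm
  set l := (n - m + 1) / 2 with hl
  have hT : ∑ i ∈ Ico l (l + m), (n.choose i : ℚ) =
      ((∑ i ∈ range m, n.choose (l + i) : ℕ) : ℚ) := by
    rw [Finset.sum_Ico_eq_sum_range]; simp
  have hlp := aux_lp (range (n + 1)) (Ico l (l + m)) (by
      intro i hi
      simp only [Finset.mem_Ico, Finset.mem_range] at hi ⊢
      omega) (frac F ∅ univ) (fun i => -(n.choose i : ℚ)) (-(n.choose l : ℚ))
    (fun i _ => frac_nonneg F _ _ i) (fun i _ => frac_le_one F _ _ (Finset.empty_subset _) i)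
    (by
      intro i hi
      simp only [Finset.mem_Ico] at hi
      simp only [neg_le_neg_iff, Nat.cast_le]
      exact aux_choose_le (by omega) (by omega))
    (by
      intro i hi hiT
      simp only [Finset.mem_Ico, Finset.mem_range] at hi hiT
      simp only [neg_le_neg_iff, Nat.cast_le]
      by_cases hil : i < l
      · exact aux_choose_le (by omega) (by omega)
      · rw [← Nat.choose_symm (by omega : i ≤ n)]
        exact aux_choose_le (by omega) (by omega))
  simp only [neg_mul, Finset.sum_neg_distrib, Nat.card_Ico, Nat.add_sub_cancel_left] at hlp
  rw [← hcard, hT] at hlp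
  have : (n.choose l : ℚ) * (∑ i ∈ range (n + 1), frac F ∅ univ i - m) ≤ 0 :=
    mul_nonpos_of_nonneg_of_nonpos (by positivity) (by linarith)
  have h' : (#F : ℚ) ≤ ((∑ i ∈ range m, n.choose (l + i) : ℕ) : ℚ) := by linarith
  exact_mod_cast h'

lemma inv_choose_top {r s : ℕ} (hs : s < r) :
    (r : ℚ) * (1 / (r.choose s)) = (r - s : ℕ) * (1 / ((r - 1).choose s)) := by
  obtain ⟨q, rfl⟩ : ∃ q, r = q + 1 := ⟨r - 1, by omega⟩
  have h := Nat.choose_mul_succ_eq q s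
  have h1 : ((q + 1).choose s : ℚ) ≠ 0 := by
    have := Nat.choose_pos (show s ≤ q + 1 by omega)
    positivity
  have h2 : (q.choose s : ℚ) ≠ 0 := by
    have := Nat.choose_pos (show s ≤ q by omega)
    positivity
  have h' : (q.choose s : ℚ) * ((q + 1 : ℕ) : ℚ) = ((q + 1).choose s) * ((q + 1 - s : ℕ) : ℚ) := by
    exact_mod_cast h
  rw [Nat.add_sub_cancel]
  field_simp
  linarith

lemma inv_choose_bot {r s : ℕ} (hs : 0 < s) (hsr : s ≤ r) :
    (r : ℚ) * (1 / (r.choose s)) = (s : ℕ) * (1 / ((r - 1).choose (s - 1))) := by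
  have h := inv_choose_top (r := r) (s := r - s) (by omega)
  rw [Nat.choose_symm hsr, show r - (r - s) = s by omega] at h
  rw [h, ← Nat.choose_symm (show s - 1 ≤ r - 1 by omega), show r - 1 - (s - 1) = r - s by omega]

lemma lub_step_top {n : ℕ} (F : Finset (Finset (Fin n))) (X Y : Finset (Fin n)) (hXY : X ⊆ Y)
    (hY : Y ∉ F) :
    ((#Y - #X : ℕ) : ℚ) * lub F X Y = ∑ y ∈ Y \ X, lub F X (Y.erase y) := by
  unfold lub
  simp only [Finset.sum_filter]
  rw [Finset.sum_comm, Finset.mul_sum]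
  apply Finset.sum_congr rfl
  intro B hB
  by_cases h : X ⊆ B ∧ B ⊆ Y
  · rw [if_pos h]
    have hlt : #B < #Y := Finset.card_lt_card (h.2.ssubset_of_ne (by rintro rfl; exact hY hB))
    have hle := Finset.card_le_card h.1
    rw [inv_choose_top (by omega)]
    have e : ∀ y ∈ Y \ X, (if X ⊆ B ∧ B ⊆ Y.erase y then
        (1 : ℚ) / ((#(Y.erase y) - #X).choose (#B - #X)) else 0) =
        if y ∈ Y \ B then (1 : ℚ) / ((#Y - #X - 1).choose (#B - #X)) else 0 := by
      intro y hy
      rw [Finset.mem_sdiff] at hy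
      rw [Finset.card_erase_of_mem hy.1, show #Y - 1 - #X = #Y - #X - 1 by omega]
      congr 1
      simp [Finset.subset_erase, h, hy.1]
    rw [Finset.sum_congr rfl e, ← Finset.sum_filter, Finset.filter_mem_eq_inter,
      Finset.inter_eq_right.2 (Finset.sdiff_subset_sdiff le_rfl h.1), Finset.sum_const,
      nsmul_eq_mul, Finset.card_sdiff_of_subset h.2,
      show #Y - #X - (#B - #X) = #Y - #B by omega]
  · rw [if_neg h, mul_zero, Finset.sum_eq_zero]
    intro y _
    rw [if_neg]
    rintro ⟨h1, h2⟩
    exact h ⟨h1, h2.trans (Finset.erase_subset _ _)⟩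

lemma lub_step_bot {n : ℕ} (F : Finset (Finset (Fin n))) (X Y : Finset (Fin n)) (hXY : X ⊆ Y)
    (hX : X ∉ F) :
    ((#Y - #X : ℕ) : ℚ) * lub F X Y = ∑ y ∈ Y \ X, lub F (insert y X) Y := by
  unfold lub
  simp only [Finset.sum_filter]
  rw [Finset.sum_comm, Finset.mul_sum]
  apply Finset.sum_congr rfl
  intro B hB
  by_cases h : X ⊆ B ∧ B ⊆ Y
  · rw [if_pos h]
    have hlt : #X < #B := Finset.card_lt_card (h.1.ssubset_of_ne (by rintro rfl; exact hX hB))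
    have hle := Finset.card_le_card h.2
    rw [inv_choose_bot (by omega) (by omega)]
    have e : ∀ y ∈ Y \ X, (if insert y X ⊆ B ∧ B ⊆ Y then
        (1 : ℚ) / ((#Y - #(insert y X)).choose (#B - #(insert y X))) else 0) =
        if y ∈ B \ X then (1 : ℚ) / ((#Y - #X - 1).choose (#B - #X - 1)) else 0 := by
      intro y hy
      rw [Finset.mem_sdiff] at hy
      rw [Finset.card_insert_of_notMem hy.2, Nat.sub_add_eq, Nat.sub_add_eq]
      congr 1
      simp [Finset.insert_subset_iff, h, hy.2]
    rw [Finset.sum_congr rfl e, ← Finset.sum_filter, Finset.filter_mem_eq_inter,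
      Finset.inter_eq_right.2 (Finset.sdiff_subset_sdiff h.2 le_rfl), Finset.sum_const,
      nsmul_eq_mul, Finset.card_sdiff_of_subset h.1]
  · rw [if_neg h, mul_zero, Finset.sum_eq_zero]
    intro y _
    rw [if_neg]
    rintro ⟨h1, h2⟩
    exact h ⟨(Finset.subset_insert _ _).trans h1, h2⟩

lemma lub_le_all {n m : ℕ} (F : Finset (Finset (Fin n)))
    (h : ∀ X ∈ F, ∀ Y ∈ F, X ⊆ Y → lub F X Y ≤ m) :
    ∀ (r : ℕ) (X Y : Finset (Fin n)), X ⊆ Y → #Y - #X = r → lub F X Y ≤ m := by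
  intro r
  induction r with
  | zero =>
    intro X Y hXY hr
    have e : X = Y := Finset.eq_of_subset_of_card_le hXY (by omega)
    subst e
    by_cases hX : X ∈ F
    · exact h X hX X hX hXY
    · unfold lub
      rw [Finset.sum_eq_zero]
      · positivity
      · intro B hB
        rw [Finset.mem_filter] at hB
        have : B = X := Finset.Subset.antisymm hB.2.2 hB.2.1
        subst this
        exact absurd hB.1 hX
  | succ r ih =>
    intro X Y hXY hr
    have hpos : (0 : ℚ) < ((#Y - #X : ℕ) : ℚ) := by rw [hr]; positivity
    have hfin : ((#Y - #X : ℕ) : ℚ) * lub F X Y ≤ ((#Y - #X : ℕ) : ℚ) * m → lub F X Y ≤ m :=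
      fun h => le_of_mul_le_mul_left h hpos
    by_cases hY : Y ∈ F
    · by_cases hX : X ∈ F
      · exact h X hX Y hY hXY
      · apply hfin
        rw [lub_step_bot F X Y hXY hX, ← Finset.card_sdiff_of_subset hXY, ← nsmul_eq_mul]
        apply Finset.sum_le_card_nsmul
        intro y hy
        rw [Finset.mem_sdiff] at hy
        apply ih _ _ (Finset.insert_subset hy.1 hXY)
        rw [Finset.card_insert_of_notMem hy.2]; omega
    · apply hfin
      rw [lub_step_top F X Y hXY hY, ← Finset.card_sdiff_of_subset hXY, ← nsmul_eq_mul]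
      apply Finset.sum_le_card_nsmul
      intro y hy
      rw [Finset.mem_sdiff] at hy
      apply ih _ _ (Finset.subset_erase.2 ⟨hXY, hy.2⟩)
      rw [Finset.card_erase_of_mem hy.1]; omega

lemma card_interval {n k : ℕ} (F : Finset (Finset (Fin n))) (hF : DkFree n k F)
    (X Y : Finset (Fin n)) (hX : X ∈ F) (hY : Y ∈ F) :
    #{B ∈ F | X ⊆ B ∧ B ⊆ Y} ≤ k + 1 := by
  by_cases hne : X = Y
  · subst hne
    have : ({B ∈ F | X ⊆ B ∧ B ⊆ X} : Finset _) ⊆ {X} := by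
      intro B hB
      rw [Finset.mem_filter] at hB
      rw [Finset.mem_singleton]
      exact Finset.Subset.antisymm hB.2.2 hB.2.1
    have := Finset.card_le_card this
    rw [Finset.card_singleton] at this
    omega
  by_contra hcon
  push Not at hcon
  apply hF
  set G : Finset (Finset (Fin n)) := ({B ∈ F | X ⊆ B ∧ B ⊆ Y} : Finset _) with hG
  have h1 : k ≤ #((G.erase X).erase Y) := by
    have h2 := Finset.pred_card_le_card_erase (s := G) (a := X)
    have h3 := Finset.pred_card_le_card_erase (s := G.erase X) (a := Y)
    omega
  obtain ⟨G', hG', hk⟩ := Finset.exists_subset_card_eq h1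
  have hmem : ∀ i, ((G'.equivFinOfCardEq hk).symm i : Finset (Fin n)) ∈ (G.erase X).erase Y :=
    fun i => hG' ((G'.equivFinOfCardEq hk).symm i).2
  simp only [Finset.mem_erase, hG, Finset.mem_filter] at hmem
  refine ⟨X, Y, fun i => ((G'.equivFinOfCardEq hk).symm i : Finset (Fin n)), hX, hY,
    fun i => (hmem i).2.2.1, ?_, fun i => ⟨(hmem i).2.1, (hmem i).1⟩, hne,
    fun i => (hmem i).2.2.2⟩
  exact Subtype.val_injective.comp (Equiv.injective _)

/-- For `k ≥ 2`, `m = ⌈log₂(k+2)⌉`, and `2^{m-1} - 1 ≤ k ≤ 2^m - C(m,⌊m/2⌋) - 1`,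
every `D_k`-free family of subsets of `[n]` has size at most `Σ(n,m)`. -/
theorem card_le_of_dkFree_case1 (k : ℕ) (hk : 2 ≤ k) (m : ℕ)
    (hm : m = Nat.clog 2 (k + 2))
    (hk1 : 2 ^ (m - 1) - 1 ≤ k) (hk2 : k ≤ 2 ^ m - m.choose (m / 2) - 1)
    (n : ℕ) (hn : 1 ≤ n)
    (F : Finset (Finset (Fin n))) (hF : DkFree n k F) :
    F.card ≤ middleBinomSum n m := by
  have hm1 : 1 ≤ m := by
    rcases Nat.eq_zero_or_pos m with h0 | h0
    · subst h0; simp at hk2; omega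
    · exact h0
  apply card_le_of_lub hm1
  refine lub_le_all F (fun X hX Y hY hXY => lub_le_of_card hm1 F X Y hXY ?_) _ _ _
    (Finset.empty_subset _) rfl
  have := card_interval F hF X Y hX hY
  omega
end
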